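/- arXiv:1310.8102 — 3 statements merged into one kernel-verified Lean document; each statement's English description precedes it below -/
import Mathlib

section
/- For 1 ≤ m ≤ n−1, if K is a generalized m-intersection body in ℝⁿ and T ∈ GL_n(ℝ), then T(K) is also a generalized m-intersection body. -/
open MeasureTheory Metric Module
open scoped ENNReal FourierTransform RealInnerProductSpace Pointwise

noncomputable section

/-- `ℝⁿ` with its Euclidean structure. -/
abbrev Euc (n : ℕ) : Type := EuclideanSpace ℝ (Fin n)

/-- The radial function of a star body: the reciprocal of the Minkowski functional (gauge). -/
def radialFn {n : ℕ} (K : Set (Euc n)) (x : Euc n) : ℝ := (gauge K x)⁻¹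

/-- A star body: compact, the origin is interior, the Minkowski functional is continuous and
positive off the origin, and `K` is the unit ball of its Minkowski functional. -/
def IsStarBody {n : ℕ} (K : Set (Euc n)) : Prop :=
  IsCompact K ∧ (0 : Euc n) ∈ interior K ∧ Continuous (gauge K) ∧
    (∀ x : Euc n, x ≠ 0 → gauge K x ≠ 0) ∧ K = {x : Euc n | gauge K x ≤ 1}

/-- The Grassmannian of `d`-dimensional linear subspaces of `ℝⁿ`. -/
def Gr (n d : ℕ) : Type := {H : Submodule ℝ (Euc n) // finrank ℝ H = d}

/-- The spherical Radon transform `R_{d} g (H) = ∫_{S^{n-1} ∩ H} g`, the integral being with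
respect to the `(d-1)`-dimensional Hausdorff measure on the sphere of the `d`-dimensional
subspace `H`. -/
def sphRadon (n d : ℕ) (g : Euc n → ℝ) (H : Gr n d) : ℝ :=
  ∫ x in sphere (0 : Euc n) 1 ∩ (H.1 : Set (Euc n)), g x ∂μH[(d : ℝ) - 1]

/-- A generalized `m`-intersection body: an origin-symmetric star body `K` such that there is a
positive continuous (= bounded) linear functional `ν` on the range of the spherical Radon
transform `R_{n-m}` with `∫_{S^{n-1}} ‖x‖_K^{-m} g(x) dx = ν (R_{n-m} g)` for all continuous
`g`. -/
def IsGenIntBody (n m : ℕ) (K : Set (Euc n)) : Prop :=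
  IsStarBody K ∧ K = -K ∧
    ∃ ν : (Gr n (n - m) → ℝ) → ℝ,
      (∀ g₁ g₂ : Euc n → ℝ, Continuous g₁ → Continuous g₂ →
        ν (sphRadon n (n - m) (g₁ + g₂)) =
          ν (sphRadon n (n - m) g₁) + ν (sphRadon n (n - m) g₂)) ∧
      (∀ (c : ℝ) (g : Euc n → ℝ), Continuous g →
        ν (sphRadon n (n - m) (c • g)) = c * ν (sphRadon n (n - m) g)) ∧
      (∀ g : Euc n → ℝ, Continuous g → (∀ H, 0 ≤ sphRadon n (n - m) g H) →
        0 ≤ ν (sphRadon n (n - m) g)) ∧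
      (∃ C : ℝ, ∀ g : Euc n → ℝ, Continuous g →
        |ν (sphRadon n (n - m) g)| ≤ C * ⨆ H : Gr n (n - m), |sphRadon n (n - m) g H|) ∧
      (∀ g : Euc n → ℝ, Continuous g →
        (∫ x in sphere (0 : Euc n) 1, radialFn K x ^ m * g x ∂μH[(n : ℝ) - 1]) =
          ν (sphRadon n (n - m) g))

/-- `D` is the `k`-intersection body of `L`: `|D ∩ H^⊥| = |L ∩ H|` for every
`(n-k)`-dimensional subspace `H`. -/
def IsKIntBodyOf (n k : ℕ) (D L : Set (Euc n)) : Prop :=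
  ∀ H : Submodule ℝ (Euc n), finrank ℝ H = n - k →
    μH[(k : ℝ)] ((Hᗮ : Set (Euc n)) ∩ D) = μH[((n - k : ℕ) : ℝ)] ((H : Set (Euc n)) ∩ L)

/-- The class of `k`-intersection bodies: the closure in the radial metric of the class of
`k`-intersection bodies of star bodies. -/
def IsKIntBody (n k : ℕ) (D : Set (Euc n)) : Prop :=
  IsStarBody D ∧ ∀ ε : ℝ, 0 < ε → ∃ D' L : Set (Euc n),
    IsStarBody D' ∧ IsStarBody L ∧ IsKIntBodyOf n k D' L ∧
    ∀ ξ ∈ sphere (0 : Euc n) 1, |radialFn D ξ - radialFn D' ξ| ≤ ε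

/-- `K` is the intersection body of the star body `L` (Lutwak): the radius of `K` in every
direction equals the `(n-1)`-dimensional volume of the central hyperplane section of `L`
perpendicular to that direction. -/
def IsIntBodyOfStar (n : ℕ) (K L : Set (Euc n)) : Prop :=
  K = -K ∧ L = -L ∧ ∀ ξ ∈ sphere (0 : Euc n) 1,
    radialFn K ξ = (μH[((n - 1 : ℕ) : ℝ)] (((ℝ ∙ ξ)ᗮ : Set (Euc n)) ∩ L)).toReal

/-- The class of intersection bodies: the closure in the radial metric of the class of
intersection bodies of star bodies. -/
def IsIntersectionBody (n : ℕ) (K : Set (Euc n)) : Prop :=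
  IsStarBody K ∧ ∀ ε : ℝ, 0 < ε → ∃ K' L : Set (Euc n),
    IsStarBody K' ∧ IsStarBody L ∧ IsIntBodyOfStar n K' L ∧
    ∀ ξ ∈ sphere (0 : Euc n) 1, |radialFn K ξ - radialFn K' ξ| ≤ ε

/-- Geometric distance between star bodies. -/
def geomDist {n : ℕ} (K L : Set (Euc n)) : ℝ :=
  sInf {r : ℝ | 0 < r ∧ ∃ a : ℝ, 0 < a ∧ K ⊆ a • L ∧ a • L ⊆ r • K}

/-- Banach–Mazur distance. -/
def bmDist {n : ℕ} (K L : Set (Euc n)) : ℝ :=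
  ⨅ T : Euc n ≃ₗ[ℝ] Euc n, geomDist K (T '' L)

/-- Banach–Mazur distance from a body to a class of bodies. -/
def bmDistClass {n : ℕ} (L : Set (Euc n)) (P : Set (Euc n) → Prop) : ℝ :=
  sInf {r : ℝ | ∃ K, P K ∧ r = bmDist L K}

/-- Volume of the unit Euclidean ball `B_2^k` in `ℝ^k`. -/
def ballVol (k : ℕ) : ℝ := (volume (ball (0 : Euc k) 1)).toReal

/-- The constant `c_{n,m} = |B_2^n|^{(n-m)/n} / |B_2^{n-m}|`. -/
def cnm (n m : ℕ) : ℝ := ballVol n ^ (((n : ℝ) - m) / n) / ballVol (n - m)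

/-- The space `(ℝⁿ, N)` embeds in `L_{-p}`, `0 < p < n`. -/
def EmbedsInLNeg (n : ℕ) (p : ℝ) (N : Euc n → ℝ) : Prop :=
  ∃ μ : Measure (sphere (0 : Euc n) 1), IsFiniteMeasure μ ∧
    ∀ φ : SchwartzMap (Euc n) ℂ, (∀ x, φ (-x) = φ x) →
      (∫ x : Euc n, (N x ^ (-p)) • φ x) =
        ∫ θ : sphere (0 : Euc n) 1,
          (∫ t : ℝ, |t| ^ (p - 1) • 𝓕 (⇑φ) (t • (θ : Euc n))) ∂μ

/-- The space `(ℝⁿ, N)` embeds in `L_q`, `q > 0`: Lévy's representation of the norm. -/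
def EmbedsInLPos (n : ℕ) (q : ℝ) (N : Euc n → ℝ) : Prop :=
  ∃ μ : Measure (sphere (0 : Euc n) 1), IsFiniteMeasure μ ∧
    ∀ x : Euc n, N x ^ q = ∫ ξ : sphere (0 : Euc n) 1, |⟪x, (ξ : Euc n)⟫| ^ q ∂μ

/-- Embedding in `L_p` for `p ≠ 0` of either sign. -/
def EmbedsInL (n : ℕ) (p : ℝ) (N : Euc n → ℝ) : Prop :=
  if 0 < p then EmbedsInLPos n p N else EmbedsInLNeg n (-p) N

/-- `N` is a norm on `ℝⁿ`. -/
def IsNormOn (n : ℕ) (N : Euc n → ℝ) : Prop :=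
  (∀ x : Euc n, N x = 0 ↔ x = 0) ∧
  (∀ (c : ℝ) (x : Euc n), N (c • x) = |c| * N x) ∧
  (∀ x y : Euc n, N (x + y) ≤ N x + N y)

/-- The `L_p([0,1])` (quasi-)norm of an a.e.-equivalence class of functions on `[0,1]`. -/
def lpNormIcc (p : ℝ) (f : ℝ →ₘ[volume.restrict (Set.Icc (0 : ℝ) 1)] ℝ) : ℝ :=
  (eLpNorm f (ENNReal.ofReal p) (volume.restrict (Set.Icc (0 : ℝ) 1))).toReal

/-- `L` is the unit ball of an `n`-dimensional subspace of `L_p([0,1])`: there is an injective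
linear map `T` from `ℝⁿ` to (equivalence classes of) functions on `[0,1]` and `L` is the unit
ball of the norm `x ↦ ‖T x‖_p`. -/
def IsUnitBallOfLpSubspace (n : ℕ) (p : ℝ) (L : Set (Euc n)) : Prop :=
  ∃ T : Euc n →ₗ[ℝ] (ℝ →ₘ[volume.restrict (Set.Icc (0 : ℝ) 1)] ℝ),
    Function.Injective T ∧ L = {x : Euc n | lpNormIcc p (T x) ≤ 1}

lemma integral_eq_smul_integral_of_measure_ball_eq {X : Type*} [MetricSpace X] [CompactSpace X]
    [MeasurableSpace X] [BorelSpace X] (μ ν : Measure X) [IsFiniteMeasure μ] (hμ0 : μ ≠ 0)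
    (hμ : ∀ (x y : X) (r : ℝ), μ (ball x r) = μ (ball y r))
    (hν : ∀ (x y : X) (r : ℝ), ν (ball x r) = ν (ball y r)) :
    ∃ c : ℝ, ∀ f : X → ℝ, Continuous f → ∫ x, f x ∂ν = c * ∫ x, f x ∂μ := by
  have key : ∀ (ρ : Measure X) (r : ℝ), 0 < r → ∃ t : Finset X, ρ Set.univ ≤ ∑ x ∈ t, ρ (ball x r) := by
    intro ρ r hr
    obtain ⟨t, -, ht, htu⟩ := finite_cover_balls_of_compact (isCompact_univ (X := X)) hr
    refine ⟨ht.toFinset, (measure_mono htu).trans ?_⟩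
    rw [show (⋃ x ∈ t, ball x r) = ⋃ x ∈ ht.toFinset, ball x r by simp]
    exact measure_biUnion_finset_le _ _
  by_cases hfin : ν Set.univ = ∞
  · refine ⟨0, fun f hf => ?_⟩
    rw [zero_mul]
    have hball : ∀ (x : X) (r : ℝ), 0 < r → ν (ball x r) = ∞ := by
      intro x r hr
      obtain ⟨t, ht⟩ := key ν r hr
      rw [hfin, top_le_iff, ENNReal.sum_eq_top] at ht
      obtain ⟨y, -, hy⟩ := ht
      rw [hν x y, hy]
    by_cases h0 : ∀ x, f x = 0
    · simp [h0]
    push Not at h0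
    obtain ⟨x, hx⟩ := h0
    apply integral_undef
    intro hint
    have hop : IsOpen {y | |f x| / 2 < ‖f y‖} := isOpen_lt continuous_const hf.norm
    have hxm : x ∈ {y | |f x| / 2 < ‖f y‖} := by
      have := abs_pos.2 hx
      rw [Set.mem_ofPred_eq, Real.norm_eq_abs]; linarith
    obtain ⟨r, hr, hsub⟩ := Metric.isOpen_iff.1 hop x hxm
    have h1 := hint.measure_norm_ge_lt_top (ε := |f x| / 2) (half_pos (abs_pos.2 hx))
    have h2 : ν (ball x r) ≤ ν {y | |f x| / 2 ≤ ‖f y‖} :=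
      by
      refine measure_mono fun y hy => ?_
      have := hsub hy
      rw [Set.mem_ofPred_eq] at this ⊢
      exact this.le
    rw [hball x r hr] at h2
    exact absurd h1 (not_lt.2 h2)
  have : IsFiniteMeasure ν := ⟨lt_top_iff_ne_top.2 hfin⟩
  have hμpos : 0 < μ.real Set.univ := by
    rw [measureReal_def]
    exact ENNReal.toReal_pos (by simpa using hμ0) (measure_ne_top _ _)
  obtain ⟨x₀⟩ : Nonempty X := by
    by_contra h
    rw [not_nonempty_iff] at h
    exact hμ0 (Measure.eq_zero_of_isEmpty μ)
  refine ⟨ν.real Set.univ / μ.real Set.univ, fun f hf => ?_⟩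
  have hmeas : ∀ r : ℝ, MeasurableSet {p : X × X | dist p.1 p.2 < r} := fun r =>
    (isOpen_lt continuous_dist continuous_const).measurableSet
  have bd : ∀ g : X → ℝ, Continuous g → ∃ M, ∀ x, ‖g x‖ ≤ M := by
    intro g hg
    obtain ⟨M, hM⟩ := isCompact_univ.exists_bound_of_continuousOn hg.continuousOn
    exact ⟨M, fun x => hM x trivial⟩
  have swap : ∀ (g : X → ℝ), Continuous g → ∀ r : ℝ,
      ∫ y, ∫ x in ball y r, g x ∂μ ∂ν = ν.real (ball x₀ r) * ∫ x, g x ∂μ := by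
    intro g hg r
    obtain ⟨M, hM⟩ := bd g hg
    have hint : Integrable (fun p : X × X => {p : X × X | dist p.1 p.2 < r}.indicator
        (fun p => g p.2) p) (ν.prod μ) := by
      refine Integrable.indicator (Integrable.of_bound
        (hg.comp continuous_snd).measurable.aestronglyMeasurable M ?_) (hmeas r)
      exact Filter.Eventually.of_forall fun p => hM p.2
    have h1 := integral_integral_swap (f := fun y x => {p : X × X | dist p.1 p.2 < r}.indicator
        (fun p => g p.2) (y, x)) hint
    calc ∫ y, ∫ x in ball y r, g x ∂μ ∂ν
        = ∫ y, ∫ x, {p : X × X | dist p.1 p.2 < r}.indicator (fun p => g p.2) (y, x) ∂μ ∂ν := by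
          congr 1; ext y
          rw [← integral_indicator measurableSet_ball]
          congr 1; ext x
          simp [Set.indicator, dist_comm]
      _ = ∫ x, g x * ν.real (ball x₀ r) ∂μ := by
          rw [h1]
          congr 1; ext x
          have : (fun y => {p : X × X | dist p.1 p.2 < r}.indicator (fun p => g p.2) (y, x))
              = (ball x r).indicator (fun _ => g x) := by
            ext y; simp [Set.indicator]
          rw [this, integral_indicator measurableSet_ball, setIntegral_const, smul_eq_mul,
            mul_comm, measureReal_def, measureReal_def, hν x x₀]
      _ = _ := by rw [integral_mul_const, mul_comm]
  have hballpos : ∀ r : ℝ, 0 < r → 0 < μ.real (ball x₀ r) := by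
    intro r hr
    rw [measureReal_def]
    refine ENNReal.toReal_pos (fun h => hμ0 ?_) (measure_ne_top _ _)
    obtain ⟨t, ht⟩ := key μ r hr
    rw [Finset.sum_eq_zero (fun y _ => (hμ y x₀ r).trans h)] at ht
    simpa using ht
  rw [← sub_eq_zero, ← abs_eq_zero]
  refine le_antisymm (le_of_forall_pos_le_add fun ε hε => ?_) (abs_nonneg _)
  rw [zero_add]
  set η := ε / (ν.real Set.univ + 1) with hη
  have hνu : 0 ≤ ν.real Set.univ := measureReal_nonneg
  have hηpos : 0 < η := by positivity
  obtain ⟨δ, hδ, hfδ⟩ := Metric.uniformContinuous_iff.1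
    (CompactSpace.uniformContinuous_of_continuous hf) η hηpos
  have hone := swap (fun _ => 1) continuous_const δ
  have hb : ∀ y, μ.real (ball y δ) = μ.real (ball x₀ δ) := fun y => by
    rw [measureReal_def, measureReal_def, hμ y x₀]
  simp only [integral_const, smul_eq_mul, mul_one, measureReal_restrict_apply_univ, hb] at hone
  have hmain := swap f hf δ
  have hP := hballpos δ hδ
  obtain ⟨M, hM⟩ := bd f hf
  have hfint : ∀ (ρ : Measure X) [IsFiniteMeasure ρ], Integrable f ρ := fun ρ _ =>
    Integrable.of_bound hf.measurable.aestronglyMeasurable M (Filter.Eventually.of_forall hM)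
  have hpt : ∀ y, ‖(∫ x in ball y δ, f x ∂μ) - f y * μ.real (ball x₀ δ)‖
      ≤ η * μ.real (ball x₀ δ) := by
    intro y
    have : (∫ x in ball y δ, f x ∂μ) - f y * μ.real (ball x₀ δ)
        = ∫ x in ball y δ, (f x - f y) ∂μ := by
      rw [integral_sub (hfint _) (integrable_const _), setIntegral_const, smul_eq_mul, hb y,
        mul_comm]
    rw [this, ← hb y]
    refine norm_setIntegral_le_of_norm_le_const (measure_lt_top _ _) fun x hx => ?_
    rw [← dist_eq_norm]
    exact (hfδ (mem_ball.1 hx)).le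
  have hgint : Integrable (fun y => ∫ x in ball y δ, f x ∂μ) ν := by
    have hm : StronglyMeasurable (fun y => ∫ x in ball y δ, f x ∂μ) := by
      have : (fun y => ∫ x in ball y δ, f x ∂μ) = fun y => ∫ x,
          {p : X × X | dist p.1 p.2 < δ}.indicator (fun p => f p.2) (y, x) ∂μ := by
        ext y
        rw [← integral_indicator measurableSet_ball]
        congr 1; ext x
        simp [Set.indicator, dist_comm]
      rw [this]
      exact (((hf.comp continuous_snd).measurable.indicator
        (hmeas δ)).stronglyMeasurable).integral_prod_right'
    refine Integrable.of_bound hm.aestronglyMeasurable (M * μ.real (ball x₀ δ))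
      (Filter.Eventually.of_forall fun y => ?_)
    rw [← hb y]
    exact norm_setIntegral_le_of_norm_le_const (measure_lt_top _ _) fun x _ => hM x
  have hdiff : |ν.real (ball x₀ δ) * ∫ x, f x ∂μ - (∫ y, f y ∂ν) * μ.real (ball x₀ δ)|
      ≤ η * μ.real (ball x₀ δ) * ν.real Set.univ := by
    rw [← hmain, ← integral_mul_const, ← integral_sub hgint ((hfint ν).mul_const _)]
    exact norm_integral_le_of_norm_le_const (Filter.Eventually.of_forall hpt)
  have hν' : ν.real (ball x₀ δ) = ν.real Set.univ / μ.real Set.univ * μ.real (ball x₀ δ) := by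
    field_simp; linarith
  rw [hν'] at hdiff
  have : (ν.real Set.univ / μ.real Set.univ * μ.real (ball x₀ δ)) * ∫ x, f x ∂μ
      - (∫ y, f y ∂ν) * μ.real (ball x₀ δ) = -μ.real (ball x₀ δ) *
      ((∫ y, f y ∂ν) - ν.real Set.univ / μ.real Set.univ * ∫ x, f x ∂μ) := by ring
  rw [this, abs_mul, abs_neg, abs_of_pos hP] at hdiff
  have h2 : |(∫ y, f y ∂ν) - ν.real Set.univ / μ.real Set.univ * ∫ x, f x ∂μ|
      ≤ η * ν.real Set.univ := by
    refine le_of_mul_le_mul_left (hdiff.trans_eq ?_) hP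
    ring
  refine h2.trans ?_
  rw [hη, div_mul_eq_mul_div, div_le_iff₀ (by positivity)]
  nlinarith

lemma integral_eq_integral_toSphere {E : Type*} [NormedAddCommGroup E] [NormedSpace ℝ E]
    [FiniteDimensional ℝ E] [Nontrivial E] [MeasurableSpace E] [BorelSpace E] (μ : Measure E)
    [μ.IsAddHaarMeasure] (F : E → ℝ) (hF : Integrable F μ) :
    ∫ x, F x ∂μ = ∫ ω : sphere (0 : E) 1,
      (∫ r in Set.Ioi (0 : ℝ), r ^ (finrank ℝ E - 1) * F (r • (ω : E))) ∂μ.toSphere := by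
  have hmp := μ.measurePreserving_homeomorphUnitSphereProd
  have hemb := (homeomorphUnitSphereProd E).measurableEmbedding
  have hcomp : ∀ x : ({0}ᶜ : Set E), F x = (fun p : sphere (0 : E) 1 × Set.Ioi (0 : ℝ) =>
      F ((p.2 : ℝ) • (p.1 : E))) (homeomorphUnitSphereProd E x) := by
    intro x
    have hx : ‖(x : E)‖ ≠ 0 := norm_ne_zero_iff.2 x.2
    simp [smul_smul, hx]
  have hint : Integrable (fun p : sphere (0 : E) 1 × Set.Ioi (0 : ℝ) =>
      F ((p.2 : ℝ) • (p.1 : E)))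
      (μ.toSphere.prod (Measure.volumeIoiPow (finrank ℝ E - 1))) := by
    rw [← hmp.integrable_comp_emb hemb]
    have : (fun p : sphere (0 : E) 1 × Set.Ioi (0 : ℝ) => F ((p.2 : ℝ) • (p.1 : E))) ∘
        homeomorphUnitSphereProd E = F ∘ Subtype.val := by
      ext x; exact (hcomp x).symm
    rw [this, ← integrableOn_iff_comap_subtypeVal (measurableSet_singleton _).compl]
    exact hF.integrableOn
  calc ∫ x, F x ∂μ = ∫ x : ({0}ᶜ : Set E), F x ∂(μ.comap (↑)) := by
        rw [integral_subtype_comap (measurableSet_singleton _).compl F,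
          restrict_compl_singleton]
    _ = ∫ p : sphere (0 : E) 1 × Set.Ioi (0 : ℝ), F ((p.2 : ℝ) • (p.1 : E))
          ∂(μ.toSphere.prod (Measure.volumeIoiPow (finrank ℝ E - 1))) := by
        rw [← hmp.integral_comp hemb]
        exact integral_congr_ae (Filter.Eventually.of_forall hcomp)
    _ = _ := by
        rw [integral_prod _ hint]
        congr 1; ext ω
        rw [Measure.volumeIoiPow, integral_withDensity_eq_integral_toReal_smul₀,
          integral_subtype_comap measurableSet_Ioi
            fun a : ℝ => (ENNReal.ofReal (a ^ (finrank ℝ E - 1))).toReal • F (a • (ω : E))]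
        · refine setIntegral_congr_fun measurableSet_Ioi fun r hr => ?_
          simp only [smul_eq_mul]
          rw [ENNReal.toReal_ofReal (pow_nonneg (le_of_lt hr) _)]
        · fun_prop
        · exact Filter.Eventually.of_forall fun _ => ENNReal.ofReal_lt_top

lemma integral_comp_normalize_mul_exp {E : Type*} [NormedAddCommGroup E] [NormedSpace ℝ E]
    [FiniteDimensional ℝ E] [Nontrivial E] [MeasurableSpace E] [BorelSpace E] (μ : Measure E)
    [μ.IsAddHaarMeasure] (A : E ≃L[ℝ] E) {f : E → ℝ} (hf : Measurable f) {M : ℝ}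
    (hM : ∀ x, ‖f x‖ ≤ M) :
    ∫ x, f (‖A x‖⁻¹ • A x) * Real.exp (-‖A x‖) ∂μ = Real.Gamma (finrank ℝ E) *
      ∫ ω : sphere (0 : E) 1,
        (‖A ω‖ ^ finrank ℝ E)⁻¹ * f (‖A ω‖⁻¹ • A ω) ∂μ.toSphere := by
  have hd : 0 < finrank ℝ E := finrank_pos
  have hdR : (0 : ℝ) < finrank ℝ E := by exact_mod_cast hd
  have hexp : Integrable (fun x : E => Real.exp (-‖x‖)) μ := by
    refine (integrable_fun_norm_addHaar μ (f := fun r : ℝ => Real.exp (-r))).2 ?_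
    refine (Real.GammaIntegral_convergent hdR).congr_fun (fun r hr => ?_) measurableSet_Ioi
    rw [← Real.rpow_natCast, Nat.cast_sub hd, smul_eq_mul, mul_comm]
    simp
  have hA : Integrable (fun x : E => Real.exp (-‖A x‖)) μ := by
    have h1 : Integrable (fun x : E => Real.exp (-‖x‖)) (Measure.map A μ) := by
      have := Measure.map_linearMap_addHaar_eq_smul_addHaar μ (f := (A : E →ₗ[ℝ] E))
        (LinearEquiv.isUnit_det' A.toLinearEquiv).ne_zero
      have h2 : Measure.map A μ = _ := this
      rw [h2]
      exact hexp.smul_measure ENNReal.ofReal_ne_top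
    exact (integrable_map_equiv A.toHomeomorph.toMeasurableEquiv _).1 h1
  have hint : Integrable (fun x => f (‖A x‖⁻¹ • A x) * Real.exp (-‖A x‖)) μ := by
    refine hA.bdd_mul (c := M) ?_ (Filter.Eventually.of_forall fun x => hM _)
    have : Measurable fun x => A x := A.continuous.measurable
    exact (hf.comp (this.norm.inv.smul this)).aestronglyMeasurable
  rw [integral_eq_integral_toSphere μ _ hint, ← integral_const_mul]
  congr 1; ext ω
  have hω : (ω : E) ≠ 0 := by
    intro h
    have := ω.2
    simp [h] at this
  have ht : 0 < ‖A ω‖ := norm_pos_iff.2 (by simpa using hω)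
  have hG := Real.integral_rpow_mul_exp_neg_mul_Ioi hdR ht
  calc _ = ∫ r in Set.Ioi (0 : ℝ), f (‖A ω‖⁻¹ • A ω) *
        (r ^ ((finrank ℝ E : ℝ) - 1) * Real.exp (-(‖A ω‖ * r))) := by
        refine setIntegral_congr_fun measurableSet_Ioi fun r hr => ?_
        have hr : (0 : ℝ) < r := hr
        simp only [map_smul, norm_smul, Real.norm_eq_abs, abs_of_pos hr]
        rw [← Real.rpow_natCast, Nat.cast_sub hd, Nat.cast_one, smul_smul,
          show (r * ‖A ω‖)⁻¹ * r = ‖A ω‖⁻¹ by field_simp, mul_comm r ‖A ω‖]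
        ring
    _ = _ := by
        rw [integral_const_mul, hG, Real.rpow_natCast]
        simp only [one_div, inv_pow]
        ring

lemma integral_toSphere_comp_linearEquiv {E : Type*} [NormedAddCommGroup E] [NormedSpace ℝ E]
    [FiniteDimensional ℝ E] [Nontrivial E] [MeasurableSpace E] [BorelSpace E] (μ : Measure E)
    [μ.IsAddHaarMeasure] (A : E ≃L[ℝ] E) {f : E → ℝ} (hf : Measurable f) {M : ℝ}
    (hM : ∀ x, ‖f x‖ ≤ M) :
    ∫ ω : sphere (0 : E) 1, f ω ∂μ.toSphere = |LinearMap.det (A : E →ₗ[ℝ] E)| *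
      ∫ ω : sphere (0 : E) 1,
        (‖A ω‖ ^ finrank ℝ E)⁻¹ * f (‖A ω‖⁻¹ • A ω) ∂μ.toSphere := by
  have hd : 0 < finrank ℝ E := finrank_pos
  have hdR : (0 : ℝ) < finrank ℝ E := by exact_mod_cast hd
  have h1 := integral_comp_normalize_mul_exp μ (ContinuousLinearEquiv.refl ℝ E) hf hM
  have h2 := integral_comp_normalize_mul_exp μ A hf hM
  have hdet : LinearMap.det (A : E →ₗ[ℝ] E) ≠ 0 :=
    (LinearEquiv.isUnit_det' A.toLinearEquiv).ne_zero
  have hmap : Measure.map A μ = _ :=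
    Measure.map_linearMap_addHaar_eq_smul_addHaar μ (f := (A : E →ₗ[ℝ] E)) hdet
  have h3 : ∫ x, f (‖A x‖⁻¹ • A x) * Real.exp (-‖A x‖) ∂μ =
      |(LinearMap.det (A : E →ₗ[ℝ] E))⁻¹| * ∫ x, f (‖x‖⁻¹ • x) * Real.exp (-‖x‖) ∂μ := by
    have := integral_map_equiv (μ := μ) A.toHomeomorph.toMeasurableEquiv
      (fun x => f (‖x‖⁻¹ • x) * Real.exp (-‖x‖))
    refine this.symm.trans ?_
    change ∫ x, f (‖x‖⁻¹ • x) * Real.exp (-‖x‖) ∂(Measure.map A μ) = _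
    rw [hmap, integral_smul_measure, ENNReal.toReal_ofReal (abs_nonneg _), smul_eq_mul]
  have hG := Real.Gamma_pos_of_pos hdR
  simp only [ContinuousLinearEquiv.coe_refl', id_eq, norm_eq_of_mem_sphere, one_pow, inv_one,
    one_mul, one_smul] at h1
  rw [h1, h2, abs_inv] at h3
  rw [mul_left_comm] at h3
  rw [mul_left_cancel₀ hG.ne' h3, mul_inv_cancel_left₀ (abs_ne_zero.2 hdet)]

lemma exists_linearIsometryEquiv_apply_eq {E : Type*} [NormedAddCommGroup E]
    [InnerProductSpace ℝ E] {x y : E} (h : ‖x‖ = ‖y‖) : ∃ R : E ≃ₗᵢ[ℝ] E, R x = y :=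
  ⟨(ℝ ∙ (x - y))ᗮ.reflection, Submodule.reflection_sub h⟩

lemma image_val_ball_sphere {E : Type*} [NormedAddCommGroup E] (x : sphere (0 : E) 1) (r : ℝ) :
    ((↑) : sphere (0 : E) 1 → E) '' ball x r = ball (x : E) r ∩ sphere 0 1 := by
  ext y
  constructor
  · rintro ⟨z, hz, rfl⟩
    exact ⟨hz, z.2⟩
  · rintro ⟨h1, h2⟩
    exact ⟨⟨y, h2⟩, h1, rfl⟩

lemma image_ball_inter_sphere {E : Type*} [NormedAddCommGroup E] [NormedSpace ℝ E]
    (R : E ≃ₗᵢ[ℝ] E) (x : E) (r : ℝ) :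
    R '' (ball x r ∩ sphere 0 1) = ball (R x) r ∩ sphere 0 1 := by
  rw [Set.image_inter R.injective, R.image_ball, R.image_sphere, map_zero]

lemma toSphere_ball_eq {E : Type*} [NormedAddCommGroup E] [InnerProductSpace ℝ E]
    [FiniteDimensional ℝ E] [MeasurableSpace E] [BorelSpace E] (x y : sphere (0 : E) 1) (r : ℝ) :
    (volume : Measure E).toSphere (ball x r) = (volume : Measure E).toSphere (ball y r) := by
  obtain ⟨R, hR⟩ := exists_linearIsometryEquiv_apply_eq (x := (x : E)) (y := y) (by simp)
  rw [Measure.toSphere_apply' _ measurableSet_ball, Measure.toSphere_apply' _ measurableSet_ball,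
    image_val_ball_sphere, image_val_ball_sphere, ← hR, ← image_ball_inter_sphere]
  congr 1
  have : Set.Ioo (0 : ℝ) 1 • (R '' (ball (x : E) r ∩ sphere 0 1)) =
      R '' (Set.Ioo (0 : ℝ) 1 • (ball (x : E) r ∩ sphere 0 1)) := by
    ext z
    simp only [Set.mem_smul, Set.mem_image]
    constructor
    · rintro ⟨t, ht, -, ⟨w, hw, rfl⟩, rfl⟩
      exact ⟨t • w, ⟨t, ht, w, hw, rfl⟩, by simp⟩
    · rintro ⟨-, ⟨t, ht, w, hw, rfl⟩, rfl⟩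
      exact ⟨t, ht, R w, ⟨w, hw, rfl⟩, by simp⟩
  rw [this, ← R.coe_toMeasurableEquiv, ← MeasurableEquiv.preimage_symm]
  exact ((R.symm.measurePreserving.measure_preimage_equiv (f := R.toMeasurableEquiv.symm) _)).symm

lemma setIntegral_sphere_hausdorffMeasure {E : Type*} [NormedAddCommGroup E]
    [InnerProductSpace ℝ E] [FiniteDimensional ℝ E] [Nontrivial E] [MeasurableSpace E]
    [BorelSpace E] (s : ℝ) :
    ∃ c : ℝ, ∀ f : E → ℝ, ContinuousOn f (sphere 0 1) →
      ∫ x in sphere (0 : E) 1, f x ∂μH[s] =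
        c * ∫ ω : sphere (0 : E) 1, f ω ∂(volume : Measure E).toSphere := by
  have hms : MeasurableSet (sphere (0 : E) 1) := isClosed_sphere.measurableSet
  obtain ⟨c, hc⟩ := integral_eq_smul_integral_of_measure_ball_eq
    (volume : Measure E).toSphere (Measure.comap ((↑) : sphere (0 : E) 1 → E) μH[s])
    (Measure.toSphere_ne_zero _) toSphere_ball_eq (fun x y r => by
      obtain ⟨R, hR⟩ := exists_linearIsometryEquiv_apply_eq (x := (x : E)) (y := y) (by simp)
      rw [comap_subtype_coe_apply hms, comap_subtype_coe_apply hms,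
        image_val_ball_sphere, image_val_ball_sphere, ← hR, ← image_ball_inter_sphere]
      exact (R.toIsometryEquiv.hausdorffMeasure_image s _).symm)
  refine ⟨c, fun f hf => ?_⟩
  rw [← integral_subtype_comap hms]
  exact hc (fun ω => f ω) (continuousOn_iff_continuous_domRestrict.1 hf)

lemma setIntegral_sphere_comp_linearEquiv {E : Type*} [NormedAddCommGroup E]
    [InnerProductSpace ℝ E] [FiniteDimensional ℝ E] [Nontrivial E] [MeasurableSpace E]
    [BorelSpace E] (s : ℝ) (A : E ≃L[ℝ] E) {f : E → ℝ} (hf : ContinuousOn f (sphere 0 1)) :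
    ∫ x in sphere (0 : E) 1, f x ∂μH[s] = |LinearMap.det (A : E →ₗ[ℝ] E)| *
      ∫ x in sphere (0 : E) 1, (‖A x‖ ^ finrank ℝ E)⁻¹ * f (‖A x‖⁻¹ • A x) ∂μH[s] := by
  classical
  obtain ⟨c, hc⟩ := setIntegral_sphere_hausdorffMeasure (E := E) s
  have hA : ∀ x ∈ sphere (0 : E) 1, ‖A x‖ ≠ 0 := by
    intro x hx h
    have : x = 0 := by simpa using h
    simp [this] at hx
  have hAs : ∀ x ∈ sphere (0 : E) 1, ‖A x‖⁻¹ • A x ∈ sphere (0 : E) 1 := by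
    intro x hx
    simp [norm_smul, hA x hx]
  have hAc : ContinuousOn (fun x => ‖A x‖) (sphere (0 : E) 1) := A.continuous.norm.continuousOn
  rw [hc f hf, hc]
  · obtain ⟨M, hM⟩ := (isCompact_sphere (0 : E) 1).exists_bound_of_continuousOn hf
    have hM0 : 0 ≤ max M 0 := le_max_right _ _
    have key := integral_toSphere_comp_linearEquiv (volume : Measure E) A
      (f := (sphere (0 : E) 1).indicator f) (M := max M 0)
      (by
        rw [← Set.piecewise_eq_indicator]
        exact hf.measurable_piecewise continuousOn_const isClosed_sphere.measurableSet)
      (fun x => by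
        by_cases hx : x ∈ sphere (0 : E) 1
        · rw [Set.indicator_of_mem hx]
          exact (hM x hx).trans (le_max_left _ _)
        · rw [Set.indicator_of_notMem hx, norm_zero]
          exact hM0)
    have h1 : ∀ ω : sphere (0 : E) 1, (sphere (0 : E) 1).indicator f ω = f ω :=
      fun ω => Set.indicator_of_mem ω.2 _
    have h2 : ∀ ω : sphere (0 : E) 1,
        (sphere (0 : E) 1).indicator f (‖A ω‖⁻¹ • A ω) = f (‖A ω‖⁻¹ • A ω) :=
      fun ω => Set.indicator_of_mem (hAs ω ω.2) _
    simp only [h1, h2] at key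
    rw [key]
    ring
  · refine ((hAc.pow _).inv₀ fun x hx => pow_ne_zero _ (hA x hx)).mul (hf.comp ?_ hAs)
    exact (hAc.inv₀ hA).smul A.continuous.continuousOn

lemma inv_abs_det_le {E : Type*} [NormedAddCommGroup E]
    [InnerProductSpace ℝ E] [FiniteDimensional ℝ E] [Nontrivial E] [MeasurableSpace E]
    [BorelSpace E] (A : E ≃L[ℝ] E) {a : ℝ} (ha : 0 < a) (hA : ∀ x, a * ‖x‖ ≤ ‖A x‖) :
    |LinearMap.det (A : E →ₗ[ℝ] E)|⁻¹ ≤ (a ^ finrank ℝ E)⁻¹ := by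
  have hdet : LinearMap.det (A : E →ₗ[ℝ] E) ≠ 0 :=
    (LinearEquiv.isUnit_det' A.toLinearEquiv).ne_zero
  have key := integral_toSphere_comp_linearEquiv (volume : Measure E) A
    (f := fun _ => 1) measurable_const (M := 1) (by simp)
  have hpos : 0 < (volume : Measure E).toSphere.real Set.univ := by
    rw [measureReal_def]
    exact ENNReal.toReal_pos
      (Measure.measure_univ_ne_zero.2 (Measure.toSphere_ne_zero (volume : Measure E)))
      (measure_ne_top _ _)
  have hle : ‖∫ ω : sphere (0 : E) 1, (‖A ω‖ ^ finrank ℝ E)⁻¹ * 1 ∂(volume : Measure E).toSphere‖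
      ≤ (a ^ finrank ℝ E)⁻¹ * (volume : Measure E).toSphere.real Set.univ := by
    refine norm_integral_le_of_norm_le_const (Filter.Eventually.of_forall fun ω => ?_)
    have := hA ω
    rw [norm_eq_of_mem_sphere, mul_one] at this
    rw [mul_one, norm_inv, norm_pow, norm_norm]
    gcongr
  rw [integral_const, smul_eq_mul, mul_one] at key
  have h2 := key.le.trans (mul_le_mul_of_nonneg_left ((le_abs_self _).trans hle) (abs_nonneg _))
  rw [← mul_assoc] at h2
  have h3 := le_of_mul_le_mul_right ((one_mul _).le.trans h2) hpos
  rw [inv_le_iff_one_le_mul₀ (abs_pos.2 hdet), mul_comm]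
  exact h3

lemma setIntegral_sphere_inter_range {E F : Type*} [NormedAddCommGroup E]
    [NormedSpace ℝ E] [NormedAddCommGroup F] [NormedSpace ℝ F] [FiniteDimensional ℝ E]
    [MeasurableSpace E] [BorelSpace E] [MeasurableSpace F] [BorelSpace F]
    (L : E →ₗᵢ[ℝ] F) {s : ℝ} (hs : 0 ≤ s) (g : F → ℝ) :
    ∫ x in sphere (0 : F) 1 ∩ Set.range L, g x ∂μH[s] =
      ∫ x in sphere (0 : E) 1, g (L x) ∂μH[s] := by
  have hL : MeasurableEmbedding L := L.isometry.isClosedEmbedding.measurableEmbedding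
  rw [← Measure.restrict_restrict isClosed_sphere.measurableSet,
    ← L.isometry.map_hausdorffMeasure (Or.inl hs), hL.setIntegral_map]
  congr 2
  ext x
  simp

lemma gauge_linearEquiv_image {E F : Type*} [AddCommGroup E] [Module ℝ E] [AddCommGroup F]
    [Module ℝ F] (T : E ≃ₗ[ℝ] F) (K : Set E) (x : F) : gauge (T '' K) x = gauge K (T.symm x) := by
  rw [gauge_def', gauge_def']
  congr 1
  ext r
  rw [Set.mem_ofPred_eq, Set.mem_ofPred_eq, ← map_smul T.symm]
  refine and_congr_right fun _ => ⟨?_, fun h => ⟨_, h, T.apply_symm_apply _⟩⟩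
  rintro ⟨y, hy, h⟩
  rwa [← h, T.symm_apply_apply]

lemma IsStarBody.linearEquiv_image {n : ℕ} {K : Set (Euc n)} (hK : IsStarBody K)
    (T : Euc n ≃ₗ[ℝ] Euc n) : IsStarBody (T '' K) := by
  obtain ⟨hc, h0, hcont, hpos, hball⟩ := hK
  have hT : Continuous T := T.toContinuousLinearEquiv.continuous
  have hTs : Continuous T.symm := T.toContinuousLinearEquiv.symm.continuous
  have hg : gauge (T '' K) = fun x => gauge K (T.symm x) :=
    funext (gauge_linearEquiv_image T K)
  refine ⟨hc.image hT, ?_, hg ▸ hcont.comp hTs, fun x hx => ?_, ?_⟩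
  · have := T.toContinuousLinearEquiv.toHomeomorph.image_interior K
    exact this ▸ ⟨0, h0, map_zero T⟩
  · rw [gauge_linearEquiv_image]
    exact hpos _ (by simpa using hx)
  · ext x
    rw [Set.mem_ofPred_eq, gauge_linearEquiv_image]
    constructor
    · rintro ⟨y, hy, rfl⟩
      rw [hball] at hy
      simpa using hy
    · intro h
      exact ⟨T.symm x, by rw [hball]; exact h, T.apply_symm_apply x⟩

/-- The image of a subspace under an invertible linear map, as a map of Grassmannians. -/
def Gr.map {n d : ℕ} (T : Euc n ≃ₗ[ℝ] Euc n) (H : Gr n d) : Gr n d :=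
  ⟨H.1.map (T : Euc n →ₗ[ℝ] Euc n), (T.finrank_map_eq H.1).trans H.2⟩

/-- On the unit sphere, the pullback along `T` of the extension of `g` that is homogeneous of
degree `-d`; the truncation at `a` makes it continuous at the origin. -/
def homogeneousPullback {n : ℕ} (T : Euc n ≃ₗ[ℝ] Euc n) (a : ℝ) (d : ℕ) (g : Euc n → ℝ)
    (x : Euc n) : ℝ :=
  (max ‖T x‖ a ^ d)⁻¹ * g ((max ‖T x‖ a)⁻¹ • T x)

section homogeneousPullback

variable {n : ℕ} {T : Euc n ≃ₗ[ℝ] Euc n} {a : ℝ}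

lemma homogeneousPullback_add (d : ℕ) (g₁ g₂ : Euc n → ℝ) :
    homogeneousPullback T a d (g₁ + g₂) =
      homogeneousPullback T a d g₁ + homogeneousPullback T a d g₂ :=
  funext fun _ => mul_add _ _ _

lemma homogeneousPullback_smul (d : ℕ) (c : ℝ) (g : Euc n → ℝ) :
    homogeneousPullback T a d (c • g) = c • homogeneousPullback T a d g :=
  funext fun _ => mul_left_comm _ _ _

lemma Continuous.homogeneousPullback (ha : 0 < a) (d : ℕ) {g : Euc n → ℝ} (hg : Continuous g) :
    Continuous (homogeneousPullback T a d g) := by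
  have hT : Continuous T := T.toContinuousLinearEquiv.continuous
  have hm : Continuous fun x => max ‖T x‖ a := hT.norm.max continuous_const
  have h0 : ∀ x, max ‖T x‖ a ≠ 0 := fun x => (lt_max_of_lt_right ha).ne'
  exact ((hm.pow d).inv₀ fun x => pow_ne_zero _ (h0 x)).mul
    (hg.comp ((hm.inv₀ h0).smul hT))

lemma homogeneousPullback_of_mem_sphere (hT : ∀ x, a * ‖x‖ ≤ ‖T x‖) (d : ℕ) (g : Euc n → ℝ)
    {x : Euc n} (hx : ‖x‖ = 1) :
    homogeneousPullback T a d g x = (‖T x‖ ^ d)⁻¹ * g (‖T x‖⁻¹ • T x) := by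
  have := hT x
  rw [hx, mul_one] at this
  rw [_root_.homogeneousPullback, max_eq_left this]

end homogeneousPullback

lemma exists_linearIsometry_range_eq {n d : ℕ} (H : Submodule ℝ (Euc n)) (hH : finrank ℝ H = d) :
    ∃ L : Euc d →ₗᵢ[ℝ] Euc n, Set.range L = H := by
  let b := (stdOrthonormalBasis ℝ H).reindex (finCongr hH)
  refine ⟨H.subtypeₗᵢ.comp b.repr.symm.toLinearIsometry, ?_⟩
  ext x
  constructor
  · rintro ⟨y, rfl⟩
    exact Subtype.coe_prop _
  · intro hx
    exact ⟨b.repr ⟨x, hx⟩, by simp⟩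

lemma exists_continuousLinearEquiv_comp_eq {E F : Type*} [NormedAddCommGroup E]
    [NormedSpace ℝ E] [FiniteDimensional ℝ E] [NormedAddCommGroup F] [NormedSpace ℝ F]
    (T : F ≃ₗ[ℝ] F) (L L' : E →ₗᵢ[ℝ] F) (h : Set.range L' = T '' Set.range L) :
    ∃ A : E ≃L[ℝ] E, ∀ x, L' (A x) = T (L x) := by
  have hex : ∀ x, ∃ y, L' y = T (L x) := fun x => by
    have : T (L x) ∈ Set.range L' := h ▸ Set.mem_image_of_mem T (Set.mem_range_self x)
    exact this
  choose A hA using hex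
  let B : E →ₗ[ℝ] E :=
    { toFun := A
      map_add' := fun x y => L'.injective (by simp only [hA, map_add])
      map_smul' := fun c x => L'.injective (by simp only [hA, map_smul, RingHom.id_apply]) }
  have hB : Function.Injective B := fun x y hxy => by
    have h1 : A x = A y := hxy
    exact L.injective (T.injective (by rw [← hA, ← hA, h1]))
  exact ⟨(LinearEquiv.ofInjectiveEndo B hB).toContinuousLinearEquiv, hA⟩

lemma nontrivial_euc {d : ℕ} (hd : 0 < d) : Nontrivial (Euc d) :=
  Module.nontrivial_of_finrank_pos (R := ℝ) (by simpa using hd)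

lemma sphRadon_eq_setIntegral_sphere {n d : ℕ} (hd : 1 ≤ d) (g : Euc n → ℝ) (H : Gr n d)
    (L : Euc d →ₗᵢ[ℝ] Euc n) (hL : Set.range L = H.1) :
    sphRadon n d g H = ∫ x in sphere (0 : Euc d) 1, g (L x) ∂μH[(d : ℝ) - 1] := by
  have hs : (0 : ℝ) ≤ (d : ℝ) - 1 := sub_nonneg.2 (by exact_mod_cast hd)
  rw [sphRadon, ← hL, setIntegral_sphere_inter_range L hs]

lemma exists_sphRadon_homogeneousPullback_eq {n d : ℕ} (hd : 1 ≤ d) (T : Euc n ≃ₗ[ℝ] Euc n)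
    {a : ℝ} (ha : 0 < a) (hT : ∀ x, a * ‖x‖ ≤ ‖T x‖) (H : Gr n d) :
    ∃ J : ℝ, 0 < J ∧ J ≤ (a ^ d)⁻¹ ∧ ∀ g : Euc n → ℝ, Continuous g →
      sphRadon n d (homogeneousPullback T a d g) H = J * sphRadon n d g (H.map T) := by
  have := nontrivial_euc hd
  obtain ⟨L, hL⟩ := exists_linearIsometry_range_eq H.1 H.2
  obtain ⟨L', hL'⟩ := exists_linearIsometry_range_eq (H.map T).1 (H.map T).2
  obtain ⟨A, hLA⟩ := exists_continuousLinearEquiv_comp_eq T L L' (by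
    rw [hL, hL']
    exact Submodule.map_coe _ _)
  have hnorm : ∀ x, ‖A x‖ = ‖T (L x)‖ := fun x => by rw [← hLA, L'.norm_map]
  have hdet : 0 < |LinearMap.det (A : Euc d →ₗ[ℝ] Euc d)| :=
    abs_pos.2 (LinearEquiv.isUnit_det' A.toLinearEquiv).ne_zero
  refine ⟨|LinearMap.det (A : Euc d →ₗ[ℝ] Euc d)|⁻¹, inv_pos.2 hdet, ?_, fun g hg => ?_⟩
  · have := inv_abs_det_le A ha fun x => by
      rw [hnorm, ← L.norm_map]
      exact hT _
    simpa using this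
  · rw [eq_inv_mul_iff_mul_eq₀ hdet.ne', sphRadon_eq_setIntegral_sphere hd _ _ L hL,
      sphRadon_eq_setIntegral_sphere hd _ _ L' hL',
      setIntegral_sphere_comp_linearEquiv _ A (f := fun x => g (L' x))
        (hg.comp L'.continuous).continuousOn]
    congr 1
    refine setIntegral_congr_fun isClosed_sphere.measurableSet fun x hx => ?_
    have hx1 : ‖L x‖ = 1 := by
      rw [L.norm_map]
      simpa using hx
    simp only [homogeneousPullback_of_mem_sphere hT d g hx1, map_smul, hnorm, hLA,
      finrank_euclideanSpace, Fintype.card_fin]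

lemma bddAbove_range_abs_sphRadon {n d : ℕ} (hd : 1 ≤ d) {g : Euc n → ℝ} (hg : Continuous g) :
    BddAbove (Set.range fun H : Gr n d => |sphRadon n d g H|) := by
  have := nontrivial_euc hd
  obtain ⟨M, hM⟩ := (isCompact_sphere (0 : Euc n) 1).exists_bound_of_continuousOn hg.continuousOn
  obtain ⟨c, hc⟩ := setIntegral_sphere_hausdorffMeasure (E := Euc d) ((d : ℝ) - 1)
  refine ⟨|c| * (M * (volume : Measure (Euc d)).toSphere.real Set.univ), ?_⟩
  rintro - ⟨H, rfl⟩
  obtain ⟨L, hL⟩ := exists_linearIsometry_range_eq H.1 H.2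
  change |sphRadon n d g H| ≤ _
  rw [sphRadon_eq_setIntegral_sphere hd g H L hL,
    hc (fun x => g (L x)) (hg.comp L.continuous).continuousOn, abs_mul]
  refine mul_le_mul_of_nonneg_left ?_ (abs_nonneg _)
  refine norm_integral_le_of_norm_le_const (Filter.Eventually.of_forall fun ω => hM _ ?_)
  rw [mem_sphere_zero_iff_norm, LinearIsometry.norm_map, norm_eq_of_mem_sphere]

lemma setIntegral_radialFn_linearEquiv_image {n m : ℕ} (hm : m ≤ n) (hn : 0 < n)
    {K : Set (Euc n)} (hK : IsStarBody K) (T : Euc n ≃ₗ[ℝ] Euc n) {a : ℝ}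
    (hT : ∀ x, a * ‖x‖ ≤ ‖T x‖) {g : Euc n → ℝ} (hg : Continuous g) (s : ℝ) :
    ∫ x in sphere (0 : Euc n) 1, radialFn (T '' K) x ^ m * g x ∂μH[s] =
      |LinearMap.det (T : Euc n →ₗ[ℝ] Euc n)| * ∫ x in sphere (0 : Euc n) 1,
        radialFn K x ^ m * homogeneousPullback T a (n - m) g x ∂μH[s] := by
  have := nontrivial_euc hn
  obtain ⟨-, -, hcont, hpos, -⟩ := hK.linearEquiv_image T
  have hf : ContinuousOn (fun x => radialFn (T '' K) x ^ m * g x) (sphere (0 : Euc n) 1) :=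
    ((hcont.continuousOn.inv₀ fun x hx =>
      hpos x (ne_of_mem_sphere hx one_ne_zero)).pow m).mul hg.continuousOn
  rw [setIntegral_sphere_comp_linearEquiv s T.toContinuousLinearEquiv hf]
  congr 1
  refine setIntegral_congr_fun isClosed_sphere.measurableSet fun x hx => ?_
  have hTx : ‖T x‖ ≠ 0 := by
    simpa using ne_of_mem_sphere hx one_ne_zero
  have hr : radialFn (T '' K) (‖T x‖⁻¹ • T x) = ‖T x‖ * radialFn K x := by
    rw [radialFn, radialFn, gauge_linearEquiv_image, map_smul, T.symm_apply_apply,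
      gauge_smul_of_nonneg (inv_nonneg.2 (norm_nonneg _)), smul_eq_mul, mul_inv, inv_inv]
  simp only [LinearEquiv.coe_toContinuousLinearEquiv', finrank_euclideanSpace, Fintype.card_fin]
  rw [hr, homogeneousPullback_of_mem_sphere hT _ _ (by simpa using hx)]
  have hsplit : ‖T x‖ ^ n = ‖T x‖ ^ m * ‖T x‖ ^ (n - m) := by
    rw [← pow_add, Nat.add_sub_cancel' hm]
  rw [hsplit, mul_pow]
  field_simp

/-- **The class of generalized m-intersection bodies is invariant under `GL_n(ℝ)`.** -/
theorem genIntBody_linear_image (n m : ℕ) (hm : 1 ≤ m) (hmn : m ≤ n - 1)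
    (K : Set (Euc n)) (hK : IsGenIntBody n m K) (T : Euc n ≃ₗ[ℝ] Euc n) :
    IsGenIntBody n m (⇑T '' K) := by
  obtain ⟨hstar, hsymm, ν, hadd, hsmul, hnonneg, ⟨C, hC⟩, hint⟩ := hK
  have hd : 1 ≤ n - m := by omega
  have hn : 0 < n := by omega
  obtain ⟨a, ha, hT⟩ : ∃ a : ℝ, 0 < a ∧ ∀ x, a * ‖x‖ ≤ ‖T x‖ := by
    have := nontrivial_euc hn
    have hpos := T.toContinuousLinearEquiv.norm_symm_pos
    refine ⟨‖(T.toContinuousLinearEquiv.symm : Euc n →L[ℝ] Euc n)‖⁻¹, inv_pos.2 hpos,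
      fun x => ?_⟩
    rw [inv_mul_le_iff₀ hpos]
    simpa using (T.toContinuousLinearEquiv.symm : Euc n →L[ℝ] Euc n).le_opNorm (T x)
  choose J hJpos hJle hJ using exists_sphRadon_homogeneousPullback_eq hd T ha hT
  have hR : ∀ g : Euc n → ℝ, Continuous g →
      (fun H : Gr n (n - m) => J H * sphRadon n (n - m) g (H.map T)) =
        sphRadon n (n - m) (homogeneousPullback T a (n - m) g) :=
    fun g hg => funext fun H => (hJ H g hg).symm
  have hdet : 0 ≤ |LinearMap.det (T : Euc n →ₗ[ℝ] Euc n)| := abs_nonneg _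
  refine ⟨hstar.linearEquiv_image T, ?_, fun F => |LinearMap.det (T : Euc n →ₗ[ℝ] Euc n)| *
    ν fun H => J H * F (H.map T), fun g₁ g₂ h₁ h₂ => ?_, fun c g hg => ?_, fun g hg hpos => ?_,
    ⟨|LinearMap.det (T : Euc n →ₗ[ℝ] Euc n)| * (|C| * (a ^ (n - m))⁻¹), fun g hg => ?_⟩,
    fun g hg => ?_⟩
  · conv_lhs => rw [hsymm]
    ext x
    constructor
    · rintro ⟨y, hy, rfl⟩
      exact ⟨-y, hy, map_neg T y⟩
    · rintro ⟨y, hy, h⟩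
      exact ⟨-y, by simpa using hy, by rw [map_neg, h, neg_neg]⟩
  · simp only
    rw [hR _ (h₁.add h₂), hR _ h₁, hR _ h₂, homogeneousPullback_add,
      hadd _ _ (h₁.homogeneousPullback ha _) (h₂.homogeneousPullback ha _), mul_add]
  · simp only
    rw [hR _ (hg.const_smul c), hR _ hg, homogeneousPullback_smul,
      hsmul _ _ (hg.homogeneousPullback ha _), mul_left_comm]
  · simp only
    rw [hR _ hg]
    refine mul_nonneg hdet (hnonneg _ (hg.homogeneousPullback ha _) fun H => ?_)
    rw [hJ H g hg]
    exact mul_nonneg (hJpos H).le (hpos _)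
  · simp only
    rw [hR _ hg, abs_mul, abs_abs, mul_assoc]
    refine mul_le_mul_of_nonneg_left ?_ hdet
    refine (hC _ (hg.homogeneousPullback ha _)).trans ?_
    rw [mul_assoc]
    have h0 : 0 ≤ ⨆ H : Gr n (n - m), |sphRadon n (n - m) g H| :=
      Real.iSup_nonneg fun _ => abs_nonneg _
    have hle : ⨆ H : Gr n (n - m),
        |sphRadon n (n - m) (homogeneousPullback T a (n - m) g) H| ≤
        (a ^ (n - m))⁻¹ * ⨆ H : Gr n (n - m), |sphRadon n (n - m) g H| := by
      refine Real.iSup_le (fun H => ?_) (by positivity)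
      rw [hJ H g hg, abs_mul, abs_of_pos (hJpos H)]
      exact mul_le_mul (hJle H) (le_ciSup (bddAbove_range_abs_sphRadon hd hg) (H.map T))
        (abs_nonneg _) (by positivity)
    exact (mul_le_mul_of_nonneg_right (le_abs_self C)
      (Real.iSup_nonneg fun _ => abs_nonneg _)).trans
      (mul_le_mul_of_nonneg_left hle (abs_nonneg _))
  · simp only
    rw [hR _ hg, setIntegral_radialFn_linearEquiv_image (by omega) hn hstar T hT hg,
      hint _ (hg.homogeneousPullback ha _)]

end
end

section
/- If L is the unit ball of an n-dimensional subspace of L_p with p > 2, then d_BM(L, B_2^n) ≤ n^{1/2 − 1/p}, where B_2^n is the unit Euclidean ball in ℝⁿ. -/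
open MeasureTheory Metric Module
open scoped ENNReal FourierTransform RealInnerProductSpace Pointwise

noncomputable section

section LewisPosition

variable {α : Type*} [MeasurableSpace α] {μ : Measure α}
  {E : Type*} [NormedAddCommGroup E] [InnerProductSpace ℝ E]

omit [InnerProductSpace ℝ E] in
theorem lp_norm_rpow_eq_integral {p : ℝ} (hp : 0 < p) (f : Lp E (ENNReal.ofReal p) μ) :
    ‖f‖ ^ p = ∫ a, ‖f a‖ ^ p ∂μ := by
  have hnn : 0 ≤ ∫ a, ‖f a‖ ^ p ∂μ := integral_nonneg fun a => by positivity
  rw [Lp.norm_def, (Lp.memLp f).eLpNorm_eq_integral_rpow_norm (by simpa using hp) (by simp),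
    ENNReal.toReal_ofReal hp.le, ENNReal.toReal_ofReal (by positivity),
    Real.rpow_inv_rpow hnn hp.ne']

variable [FiniteDimensional ℝ E]

/-- Among the linear images of a nondegenerate vector-valued `L_p` function, one of unit norm has
maximal determinant; the maximality is stated in homogeneous form. -/
theorem exists_compLp_maximal_det [Nontrivial E] {p : ℝ≥0∞} [Fact (1 ≤ p)] (F : Lp E p μ)
    (hF : ∀ B : E →L[ℝ] E, B.compLp F = 0 → B = 0) :
    ∃ A : E →L[ℝ] E, LinearMap.det (A : E →ₗ[ℝ] E) ≠ 0 ∧ ‖A.compLp F‖ = 1 ∧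
      ∀ B : E →L[ℝ] E, |LinearMap.det (B : E →ₗ[ℝ] E)| ≤
        |LinearMap.det (A : E →ₗ[ℝ] E)| * ‖B.compLp F‖ ^ finrank ℝ E := by
  let Λ : (E →L[ℝ] E) →ₗ[ℝ] Lp E p μ :=
    { toFun := fun B => B.compLp F
      map_add' := fun B C => B.add_compLp C F
      map_smul' := fun c B => B.smul_compLp c F }
  have hΛ : Topology.IsClosedEmbedding Λ :=
    LinearMap.isClosedEmbedding_of_injective
      (LinearMap.ker_eq_bot'.2 hF)
  have hpos : ∀ B : E →L[ℝ] E, B ≠ 0 → 0 < ‖Λ B‖ := fun B hB =>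
    norm_pos_iff.2 fun h => hB (hF B h)
  have hbdd : Bornology.IsBounded {B : E →L[ℝ] E | ‖Λ B‖ ≤ 1} := by
    obtain ⟨K, hK0, hK⟩ := Λ.exists_antilipschitzWith (LinearMap.ker_eq_bot'.2 hF)
    have := hK.isBounded_preimage (isBounded_closedBall (x := (0 : Lp E p μ)) (r := 1))
    refine this.subset fun B hB => ?_
    simpa using hB
  have hcomp : IsCompact {B : E →L[ℝ] E | ‖Λ B‖ ≤ 1} :=
    isCompact_of_isClosed_isBounded
      (isClosed_le hΛ.continuous.norm continuous_const) hbdd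
  have hdet : Continuous fun B : E →L[ℝ] E => |LinearMap.det (B : E →ₗ[ℝ] E)| :=
    ContinuousLinearMap.continuous_det.abs
  obtain ⟨A, hA1, hAmax⟩ := hcomp.exists_isMaxOn ⟨0, by simp⟩ hdet.continuousOn
  have hscale : ∀ (c : ℝ) (B : E →L[ℝ] E), |LinearMap.det ((c • B : E →L[ℝ] E) : E →ₗ[ℝ] E)| =
      |c| ^ finrank ℝ E * |LinearMap.det (B : E →ₗ[ℝ] E)| := fun c B => by
    rw [ContinuousLinearMap.toLinearMap_smul, LinearMap.det_smul, abs_mul, abs_pow]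
  have hmax : ∀ B : E →L[ℝ] E, |LinearMap.det (B : E →ₗ[ℝ] E)| ≤
        |LinearMap.det (A : E →ₗ[ℝ] E)| * ‖B.compLp F‖ ^ finrank ℝ E := by
    intro B
    rcases eq_or_ne B 0 with rfl | hB
    · rw [ContinuousLinearMap.toLinearMap_zero, LinearMap.det_zero,
        zero_pow finrank_pos.ne', abs_zero]
      positivity
    · have hB' := hpos B hB
      have hmem : (‖Λ B‖⁻¹ • B) ∈ {B : E →L[ℝ] E | ‖Λ B‖ ≤ 1} := by
        simp only [Set.mem_ofPred_eq, map_smul, norm_smul, norm_inv, norm_norm]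
        rw [inv_mul_cancel₀ hB'.ne']
      have h := hAmax hmem
      simp only [Set.mem_ofPred_eq] at h
      rw [hscale, abs_inv, abs_norm, inv_pow, inv_mul_le_iff₀ (by positivity), mul_comm] at h
      exact h
  have hA0 : 0 < |LinearMap.det (A : E →ₗ[ℝ] E)| := by
    have h := hmax (ContinuousLinearMap.id ℝ E)
    rw [ContinuousLinearMap.coe_id, LinearMap.det_id, abs_one] at h
    by_contra h0
    have : |LinearMap.det (A : E →ₗ[ℝ] E)| = 0 := le_antisymm (not_lt.1 h0) (abs_nonneg _)
    rw [this, zero_mul] at h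
    linarith
  refine ⟨A, abs_pos.1 hA0, le_antisymm hA1 ?_, hmax⟩
  have h := hmax A
  by_contra hlt
  have : ‖A.compLp F‖ ^ finrank ℝ E < 1 :=
    pow_lt_one₀ (norm_nonneg _) (not_le.1 hlt) finrank_pos.ne'
  nlinarith

omit [FiniteDimensional ℝ E] in
theorem hasDerivAt_integral_norm_sq_add_inner_sq_rpow {p : ℝ} (hp : 2 < p) {g : α → E}
    (hg : MemLp g (ENNReal.ofReal p) μ) {u : E} (hu : ‖u‖ = 1) :
    HasDerivAt (fun δ : ℝ => ∫ a, (‖g a‖ ^ 2 + δ * ⟪u, g a⟫ ^ 2) ^ (p / 2) ∂μ)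
      (p / 2 * ∫ a, ‖g a‖ ^ (p - 2) * ⟪u, g a⟫ ^ 2 ∂μ) 0 := by
  have hinner : ∀ a, ⟪u, g a⟫ ^ 2 ≤ ‖g a‖ ^ 2 := fun a => by
    have := abs_real_inner_le_norm u (g a)
    rw [hu, one_mul] at this
    exact sq_le_sq.2 (by rwa [abs_norm])
  have hgm : AEStronglyMeasurable g μ := hg.1
  have hnorm : AEMeasurable (fun a => ‖g a‖) μ := hgm.norm.aemeasurable
  have him : AEMeasurable (fun a => ⟪u, g a⟫) μ :=
    (AEStronglyMeasurable.inner aestronglyMeasurable_const hgm).aemeasurable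
  have hgp : Integrable (fun a => ‖g a‖ ^ p) μ := by
    have := hg.integrable_norm_rpow (by simp; linarith) (by simp)
    rwa [ENNReal.toReal_ofReal (by linarith)] at this
  have hpow : ∀ (x q : ℝ), 0 ≤ x → (x ^ 2) ^ q = x ^ (2 * q) := fun x q hx => by
    rw [Real.rpow_mul hx, Real.rpow_two]
  have h := hasDerivAt_integral_of_dominated_loc_of_deriv_le (μ := μ) (x₀ := (0 : ℝ))
    (s := ball (0 : ℝ) 1)
    (F := fun δ a => (‖g a‖ ^ 2 + δ * ⟪u, g a⟫ ^ 2) ^ (p / 2))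
    (F' := fun δ a => ⟪u, g a⟫ ^ 2 * (p / 2) * (‖g a‖ ^ 2 + δ * ⟪u, g a⟫ ^ 2) ^ (p / 2 - 1))
    (bound := fun a => (p / 2 * 2 ^ (p / 2 - 1)) * ‖g a‖ ^ p)
    (ball_mem_nhds _ one_pos)
    (Filter.Eventually.of_forall fun δ => AEMeasurable.aestronglyMeasurable (by fun_prop))
    ?_ (AEMeasurable.aestronglyMeasurable (by fun_prop)) ?_ (hgp.const_mul _) ?_
  · have h' := h.2
    refine h'.congr_deriv ?_
    rw [← integral_const_mul]
    congr 1 with a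
    rw [zero_mul, add_zero, hpow _ _ (norm_nonneg _), show 2 * (p / 2 - 1) = p - 2 by ring]
    ring
  · convert hgp using 2 with a
    rw [zero_mul, add_zero, hpow _ _ (norm_nonneg _), show 2 * (p / 2) = p by ring]
  · refine Filter.Eventually.of_forall fun a δ hδ => ?_
    rw [mem_ball_zero_iff, Real.norm_eq_abs, abs_lt] at hδ
    have h0 : 0 ≤ ‖g a‖ ^ 2 + δ * ⟪u, g a⟫ ^ 2 := by
      nlinarith [hinner a, sq_nonneg ⟪u, g a⟫]
    have h1 : ‖g a‖ ^ 2 + δ * ⟪u, g a⟫ ^ 2 ≤ 2 * ‖g a‖ ^ 2 := by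
      nlinarith [hinner a, sq_nonneg ⟪u, g a⟫]
    rw [Real.norm_of_nonneg (by positivity)]
    calc ⟪u, g a⟫ ^ 2 * (p / 2) * (‖g a‖ ^ 2 + δ * ⟪u, g a⟫ ^ 2) ^ (p / 2 - 1)
        ≤ ‖g a‖ ^ 2 * (p / 2) * (2 * ‖g a‖ ^ 2) ^ (p / 2 - 1) := by
          have := Real.rpow_le_rpow h0 h1 (show 0 ≤ p / 2 - 1 by linarith)
          have := hinner a
          gcongr
      _ = (p / 2 * 2 ^ (p / 2 - 1)) * ‖g a‖ ^ p := by
          have : ‖g a‖ ^ p = ‖g a‖ ^ 2 * ‖g a‖ ^ (p - 2) := by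
            rw [← Real.rpow_two, ← Real.rpow_add_of_nonneg (norm_nonneg _) (by norm_num)
              (by linarith)]
            congr 1; ring
          rw [Real.mul_rpow (by norm_num) (by positivity), hpow _ _ (norm_nonneg _), this,
            show 2 * (p / 2 - 1) = p - 2 by ring]
          ring
  · refine Filter.Eventually.of_forall fun a δ _ => ?_
    refine HasDerivAt.rpow_const ?_ (Or.inr (by linarith))
    simpa using ((hasDerivAt_id δ).mul_const (⟪u, g a⟫ ^ 2)).const_add (‖g a‖ ^ 2)

omit [FiniteDimensional ℝ E] in
theorem norm_add_smul_inner_smul_sq {u : E} (hu : ‖u‖ = 1) (ε : ℝ) (x : E) :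
    ‖x + (ε * ⟪u, x⟫) • u‖ ^ 2 = ‖x‖ ^ 2 + ((1 + ε) ^ 2 - 1) * ⟪u, x⟫ ^ 2 := by
  rw [norm_add_sq_real, inner_smul_right, norm_smul, hu, real_inner_comm x u, mul_one,
    Real.norm_eq_abs, sq_abs]
  ring

/-- **Lewis position.** A nondegenerate vector-valued `L_p` function, `p > 2`, has a linear image
`g` of unit norm such that the density `‖g‖ ^ (p - 2)` makes `g` isotropic. -/
theorem exists_compLp_isotropic [Nontrivial E] {p : ℝ} (hp : 2 < p)
    (F : Lp E (ENNReal.ofReal p) μ)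
    (hF : ∀ B : E →L[ℝ] E, B.compLp F = 0 → B = 0) :
    ∃ A : E →L[ℝ] E, LinearMap.det (A : E →ₗ[ℝ] E) ≠ 0 ∧
      ∫ a, ‖A.compLp F a‖ ^ p ∂μ = 1 ∧
      ∀ u : E, ∫ a, ‖A.compLp F a‖ ^ (p - 2) * ⟪u, A.compLp F a⟫ ^ 2 ∂μ =
        ‖u‖ ^ 2 / finrank ℝ E := by
  have : Fact (1 ≤ ENNReal.ofReal p) := ⟨by simp; linarith⟩
  obtain ⟨A, hA, hA1, hmax⟩ := exists_compLp_maximal_det F hF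
  have hI : ∫ a, ‖A.compLp F a‖ ^ p ∂μ = 1 := by
    rw [← lp_norm_rpow_eq_integral (by linarith), hA1, Real.one_rpow]
  have hn : (0 : ℝ) < finrank ℝ E := by exact_mod_cast finrank_pos
  refine ⟨A, hA, hI, ?_⟩
  set g := A.compLp F with hg
  have hunit : ∀ u : E, ‖u‖ = 1 →
      ∫ a, ‖g a‖ ^ (p - 2) * ⟪u, g a⟫ ^ 2 ∂μ = 1 / finrank ℝ E := by
    intro u hu
    set ψ : ℝ → ℝ := fun δ => ∫ a, (‖g a‖ ^ 2 + δ * ⟪u, g a⟫ ^ 2) ^ (p / 2) ∂μ with hψ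
    have hψ0 : ψ 0 = 1 := by
      rw [← hI]
      simp only [hψ]
      congr 1 with a
      rw [zero_mul, add_zero, ← Real.rpow_two, ← Real.rpow_mul (norm_nonneg _),
        show 2 * (p / 2) = p by ring]
    have hder := hasDerivAt_integral_norm_sq_add_inner_sq_rpow hp (Lp.memLp g) hu
    have hineq : ∀ δ : ℝ, -1 < δ → (1 + δ) ^ (p / 2) ≤ ψ δ ^ finrank ℝ E := by
      intro δ hδ
      have hsq : √(1 + δ) ^ 2 = 1 + δ := Real.sq_sqrt (by linarith)
      let S : E →L[ℝ] E := LinearMap.toContinuousLinearMap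
        (LinearMap.transvection ((√(1 + δ) - 1) • (innerₗ E u)) u)
      have hS : ∀ x, S x = x + ((√(1 + δ) - 1) * ⟪u, x⟫) • u := fun x => by
        simp [S, LinearMap.transvection]
      have hSdet : LinearMap.det (S : E →ₗ[ℝ] E) = √(1 + δ) := by
        simp [S, hu]
      have hb := hmax (S ∘L A)
      rw [ContinuousLinearMap.toLinearMap_comp, LinearMap.det_comp, hSdet, abs_mul,
        mul_comm |√(1 + δ)|, abs_of_nonneg (Real.sqrt_nonneg _)] at hb
      have hb' := le_of_mul_le_mul_left hb (abs_pos.2 hA)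
      have hnorm : ‖(S ∘L A).compLp F‖ ^ p = ψ δ := by
        rw [lp_norm_rpow_eq_integral (by linarith)]
        refine integral_congr_ae ?_
        filter_upwards [(S ∘L A).coeFn_compLp F, A.coeFn_compLp F] with a h1 h2
        have hga : g a = A (F a) := h2
        have h3 := norm_add_smul_inner_smul_sq hu (√(1 + δ) - 1) (A (F a))
        rw [add_sub_cancel, hsq, add_sub_cancel_left] at h3
        rw [h1, hga, ContinuousLinearMap.comp_apply, hS, ← h3, ← Real.rpow_two,
          ← Real.rpow_mul (norm_nonneg _), show 2 * (p / 2) = p by ring]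
      calc (1 + δ) ^ (p / 2) = √(1 + δ) ^ p := by
            conv_lhs => rw [← hsq]
            rw [← Real.rpow_two, ← Real.rpow_mul (Real.sqrt_nonneg _),
              show 2 * (p / 2) = p by ring]
        _ ≤ (‖(S ∘L A).compLp F‖ ^ finrank ℝ E) ^ p :=
            Real.rpow_le_rpow (Real.sqrt_nonneg _) hb' (by linarith)
        _ = ψ δ ^ finrank ℝ E := by
            rw [← hnorm, ← Real.rpow_natCast, ← Real.rpow_natCast, ← Real.rpow_mul (norm_nonneg _),
              ← Real.rpow_mul (norm_nonneg _), mul_comm]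
    have hmin : IsLocalMin (fun δ => ψ δ ^ finrank ℝ E - (1 + δ) ^ (p / 2)) 0 := by
      filter_upwards [Ioi_mem_nhds (show (-1 : ℝ) < 0 by norm_num)] with δ hδ
      simp only [hψ0, add_zero, one_pow, Real.one_rpow, sub_self]
      exact sub_nonneg.2 (hineq δ hδ)
    have hd2 : HasDerivAt (fun δ : ℝ => (1 + δ) ^ (p / 2)) (p / 2) 0 := by
      have := ((hasDerivAt_id (0 : ℝ)).const_add 1).rpow_const (p := p / 2)
        (Or.inr (by linarith))
      simpa using this
    have h0 := hmin.hasDerivAt_eq_zero ((hder.pow (finrank ℝ E)).sub hd2)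
    have hψ0' := hψ0
    simp only [hψ] at hψ0'
    rw [hψ0', one_pow, mul_one] at h0
    rw [eq_div_iff hn.ne']
    have hp0 : p ≠ 0 := by linarith
    field_simp at h0
    linarith [(mul_eq_zero.1 (h0.trans (mul_zero 2))).resolve_left hp0]
  intro u
  rcases eq_or_ne u 0 with rfl | hu
  · simp
  have hu0 : ‖u‖ ≠ 0 := norm_ne_zero_iff.2 hu
  have h := hunit (‖u‖⁻¹ • u) (by rw [norm_smul, norm_inv, norm_norm, inv_mul_cancel₀ hu0])
  have h2 : ∀ a, ‖g a‖ ^ (p - 2) * ⟪‖u‖⁻¹ • u, g a⟫ ^ 2 =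
      (‖u‖ ^ 2)⁻¹ * (‖g a‖ ^ (p - 2) * ⟪u, g a⟫ ^ 2) := fun a => by
    rw [real_inner_smul_left]; ring
  simp_rw [h2] at h
  rw [integral_const_mul, inv_mul_eq_iff_eq_mul₀ (by positivity)] at h
  rw [h]; ring
/-- The two-sided comparison with the Euclidean norm in Lewis position. -/
theorem exists_linearEquiv_integral_inner_rpow_le [Nontrivial E] {p : ℝ} (hp : 2 < p)
    (F : Lp E (ENNReal.ofReal p) μ)
    (hF : ∀ B : E →L[ℝ] E, B.compLp F = 0 → B = 0) :
    ∃ S : E ≃ₗ[ℝ] E, ∀ u : E,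
      ∫ a, |⟪S u, F a⟫| ^ p ∂μ ≤ ‖u‖ ^ p / finrank ℝ E ∧
      ‖u‖ ^ 2 ≤ finrank ℝ E * (∫ a, |⟪S u, F a⟫| ^ p ∂μ) ^ (2 / p) := by
  obtain ⟨A, hA, hI, hiso⟩ := exists_compLp_isotropic hp F hF
  have hn : (0 : ℝ) < finrank ℝ E := by exact_mod_cast finrank_pos
  have hp0 : 0 < p := by linarith
  set g := A.compLp F with hg
  have hA' : Function.Injective (ContinuousLinearMap.adjoint A : E →ₗ[ℝ] E) := by
    have hsurj : Function.Surjective (A : E →ₗ[ℝ] E) :=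
      (LinearMap.equivOfDetNeZero (A : E →ₗ[ℝ] E) hA).surjective
    refine (injective_iff_map_eq_zero _).2 fun v hv => ?_
    obtain ⟨w, hw⟩ := hsurj v
    have h : ⟪ContinuousLinearMap.adjoint A v, w⟫ = ⟪v, A w⟫ :=
      ContinuousLinearMap.adjoint_inner_left A w v
    have hv' : ContinuousLinearMap.adjoint A v = 0 := hv
    have hw' : A w = v := hw
    rw [hv', hw', inner_zero_left] at h
    exact inner_self_eq_zero.1 h.symm
  refine ⟨LinearEquiv.ofInjectiveEndo _ hA', fun u => ?_⟩
  have hSu : ∫ a, |⟪LinearEquiv.ofInjectiveEndo _ hA' u, F a⟫| ^ p ∂μ =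
      ∫ a, |⟪u, g a⟫| ^ p ∂μ := by
    refine integral_congr_ae ?_
    filter_upwards [A.coeFn_compLp F] with a ha
    have hga : g a = A (F a) := ha
    rw [hga]
    congr 2
    exact ContinuousLinearMap.adjoint_inner_left A (F a) u
  rw [hSu]
  have hgL : MemLp g (ENNReal.ofReal p) μ := Lp.memLp g
  have hsplit : ∀ x : ℝ, 0 ≤ x → x ^ p = x ^ (p - 2) * x ^ 2 := fun x hx => by
    rw [← Real.rpow_two, ← Real.rpow_add_of_nonneg hx (by linarith) (by norm_num)]
    congr 1; ring
  have hgp : Integrable (fun a => ‖g a‖ ^ p) μ := by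
    have := hgL.integrable_norm_rpow (by simpa using hp0) (by simp)
    rwa [ENNReal.toReal_ofReal hp0.le] at this
  have hnorm : AEMeasurable (fun a => ‖g a‖) μ := hgL.1.norm.aemeasurable
  have him : AEMeasurable (fun a => ⟪u, g a⟫) μ :=
    (AEStronglyMeasurable.inner aestronglyMeasurable_const hgL.1).aemeasurable
  have hinner : ∀ a, |⟪u, g a⟫| ≤ ‖u‖ * ‖g a‖ := fun a => abs_real_inner_le_norm u (g a)
  have hint : Integrable (fun a => ‖g a‖ ^ (p - 2) * ⟪u, g a⟫ ^ 2) μ := by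
    refine (hgp.const_mul (‖u‖ ^ 2)).mono' (AEMeasurable.aestronglyMeasurable (by fun_prop))
      (Filter.Eventually.of_forall fun a => ?_)
    rw [Real.norm_of_nonneg (by positivity), hsplit _ (norm_nonneg _), ← sq_abs ⟪u, g a⟫]
    calc ‖g a‖ ^ (p - 2) * |⟪u, g a⟫| ^ 2 ≤ ‖g a‖ ^ (p - 2) * (‖u‖ * ‖g a‖) ^ 2 := by
          have := hinner a
          gcongr
      _ = _ := by ring
  constructor
  · calc ∫ a, |⟪u, g a⟫| ^ p ∂μ
        ≤ ∫ a, ‖u‖ ^ (p - 2) * (‖g a‖ ^ (p - 2) * ⟪u, g a⟫ ^ 2) ∂μ := by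
          refine integral_mono_of_nonneg (Filter.Eventually.of_forall fun a => by positivity)
            (hint.const_mul _) (Filter.Eventually.of_forall fun a => ?_)
          simp only
          rw [hsplit _ (abs_nonneg _), sq_abs, ← mul_assoc,
            ← Real.mul_rpow (norm_nonneg _) (norm_nonneg _)]
          have := Real.rpow_le_rpow (abs_nonneg _) (hinner a) (show 0 ≤ p - 2 by linarith)
          gcongr
      _ = ‖u‖ ^ p / finrank ℝ E := by
          rw [integral_const_mul, hiso, hsplit _ (norm_nonneg u)]
          ring
  · have hp2 : 0 < p - 2 := by linarith
    have hconj : (p / (p - 2)).HolderConjugate (p / 2) := by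
      rw [Real.holderConjugate_iff]
      refine ⟨by rw [lt_div_iff₀ hp2]; linarith, ?_⟩
      field_simp
      ring
    have h1 : MemLp (fun a => ‖g a‖ ^ (p - 2)) (ENNReal.ofReal (p / (p - 2))) μ := by
      have := hgL.norm_rpow_div (ENNReal.ofReal (p - 2))
      rwa [ENNReal.toReal_ofReal hp2.le, ← ENNReal.ofReal_div_of_pos hp2] at this
    have h2 : MemLp (fun a => ⟪u, g a⟫ ^ 2) (ENNReal.ofReal (p / 2)) μ := by
      have := (hgL.const_inner (𝕜 := ℝ) u).norm_rpow_div (ENNReal.ofReal 2)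
      rw [ENNReal.toReal_ofReal (by norm_num), ← ENNReal.ofReal_div_of_pos (by norm_num)] at this
      simpa [Real.rpow_two] using this
    have h := integral_mul_le_Lp_mul_Lq_of_nonneg hconj
      (Filter.Eventually.of_forall fun a => by positivity)
      (Filter.Eventually.of_forall fun a => by positivity) h1 h2
    have e1 : ∀ a, (‖g a‖ ^ (p - 2)) ^ (p / (p - 2)) = ‖g a‖ ^ p := fun a => by
      rw [← Real.rpow_mul (norm_nonneg _), mul_div_cancel₀ _ hp2.ne']
    have e2 : ∀ a, (⟪u, g a⟫ ^ 2) ^ (p / 2) = |⟪u, g a⟫| ^ p := fun a => by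
      rw [← sq_abs, ← Real.rpow_two, ← Real.rpow_mul (abs_nonneg _),
        mul_div_cancel₀ _ (by norm_num)]
    simp only [e1, e2] at h
    rw [hiso, hI, Real.one_rpow, one_mul, div_le_iff₀ hn, one_div_div] at h
    rw [mul_comm]
    exact h

end LewisPosition

/-- Coordinates: a linear map into classes of functions with all values in `L_p` is given by
pairing with one vector-valued `L_p` function. -/
theorem exists_lp_inner_ae_eq {α : Type*} [MeasurableSpace α] {μ : Measure α} {n : ℕ} {p : ℝ≥0∞}
    (T : Euc n →ₗ[ℝ] (α →ₘ[μ] ℝ)) (hT : ∀ x, MemLp (T x) p μ) :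
    ∃ F : Lp (Euc n) p μ, ∀ x, (T x : α → ℝ) =ᵐ[μ] fun a => ⟪x, F a⟫ := by
  let b := EuclideanSpace.basisFun (Fin n) ℝ
  have hmem : MemLp (fun a => ∑ i, T (b i) a • b i) p μ :=
    memLp_finsetSum _ fun i _ => by
      have := (ContinuousLinearMap.toSpanSingleton ℝ (b i)).comp_memLp' (hT (b i))
      simpa [Function.comp_def] using this
  refine ⟨hmem.toLp _, fun x => ?_⟩
  have hsum : ∀ s : Finset (Fin n), ((∑ i ∈ s, x i • T (b i) : α →ₘ[μ] ℝ) : α → ℝ) =ᵐ[μ]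
      fun a => ∑ i ∈ s, x i * T (b i) a := by
    intro s
    induction s using Finset.induction_on with
    | empty =>
      simp only [Finset.sum_empty]
      exact AEEqFun.coeFn_zero
    | insert i s hi ih =>
      rw [Finset.sum_insert hi]
      filter_upwards [ih, AEEqFun.coeFn_add (x i • T (b i)) (∑ i ∈ s, x i • T (b i)),
        AEEqFun.coeFn_smul (x i) (T (b i))] with a h1 h2 h3
      rw [h2, Pi.add_apply, h1, h3, Finset.sum_insert hi, Pi.smul_apply, smul_eq_mul]
  have hx : T x = ∑ i, x i • T (b i) := by
    conv_lhs => rw [← b.sum_repr x]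
    simp [b]
  rw [hx]
  filter_upwards [hsum Finset.univ, hmem.coeFn_toLp] with a h1 h2
  rw [h1, h2, inner_sum]
  refine Finset.sum_congr rfl fun i _ => ?_
  have hi : ⟪x, b i⟫ = x i := by
    rw [real_inner_comm]
    exact EuclideanSpace.basisFun_inner (Fin n) ℝ x i
  rw [inner_smul_right, mul_comm, hi]

theorem geomDist_nonneg {n : ℕ} (K L : Set (Euc n)) : 0 ≤ geomDist K L :=
  Real.sInf_nonneg fun _ hr => hr.1.le

theorem bmDist_le_geomDist {n : ℕ} (K L : Set (Euc n)) (T : Euc n ≃ₗ[ℝ] Euc n) :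
    bmDist K L ≤ geomDist K (T '' L) :=
  ciInf_le ⟨0, Set.forall_mem_range.2 fun _ => geomDist_nonneg _ _⟩ T

theorem bmDist_le_of_subset {n : ℕ} {K L : Set (Euc n)} (T : Euc n ≃ₗ[ℝ] Euc n) {r a : ℝ}
    (hr : 0 < r) (ha : 0 < a) (h₁ : K ⊆ a • (T '' L)) (h₂ : a • (T '' L) ⊆ r • K) :
    bmDist K L ≤ r :=
  (bmDist_le_geomDist K L T).trans (csInf_le ⟨0, fun _ hr => hr.1.le⟩ ⟨hr, a, ha, h₁, h₂⟩)

/-- An unbounded set has Banach–Mazur distance `0` (the default value) from the ball. -/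
theorem bmDist_closedBall_le_zero_of_not_isBounded {n : ℕ} {K : Set (Euc n)}
    (hK : ¬ Bornology.IsBounded K) : bmDist K (closedBall (0 : Euc n) 1) ≤ 0 := by
  refine (bmDist_le_geomDist _ _ (LinearEquiv.refl ℝ (Euc n))).trans (le_of_eq ?_)
  unfold geomDist
  convert Real.sInf_empty
  refine Set.eq_empty_iff_forall_notMem.2 ?_
  rintro r ⟨-, a, -, h, -⟩
  refine hK (Bornology.IsBounded.subset ?_ h)
  rw [show ⇑(LinearEquiv.refl ℝ (Euc n)) = id from rfl, Set.image_id]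
  exact (isBounded_closedBall (x := (0 : Euc n)) (r := 1)).smul₀ a

theorem not_isBounded_lpBall_of_not_memLp {n : ℕ} {p : ℝ}
    (T : Euc n →ₗ[ℝ] (ℝ →ₘ[volume.restrict (Set.Icc (0 : ℝ) 1)] ℝ)) {x : Euc n}
    (hx : ¬ MemLp (T x) (ENNReal.ofReal p) (volume.restrict (Set.Icc (0 : ℝ) 1))) :
    ¬ Bornology.IsBounded {x : Euc n | lpNormIcc p (T x) ≤ 1} := by
  have hx0 : x ≠ 0 := by
    rintro rfl
    rw [map_zero] at hx
    exact hx ((memLp_congr_ae AEEqFun.coeFn_zero).2 MemLp.zero)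
  have hmem : ∀ c : ℝ, 0 < c → c • x ∈ {x : Euc n | lpNormIcc p (T x) ≤ 1} := by
    intro c hc
    have hinf : ¬ MemLp (T (c • x)) (ENNReal.ofReal p)
        (volume.restrict (Set.Icc (0 : ℝ) 1)) := by
      intro h
      rw [map_smul, memLp_congr_ae (AEEqFun.coeFn_smul c (T x))] at h
      have := h.const_smul c⁻¹
      rw [inv_smul_smul₀ hc.ne'] at this
      exact hx this
    have htop : eLpNorm (T (c • x)) (ENNReal.ofReal p)
        (volume.restrict (Set.Icc (0 : ℝ) 1)) = ∞ := by
      by_contra hne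
      exact hinf ⟨AEEqFun.aestronglyMeasurable _, lt_top_iff_ne_top.2 hne⟩
    rw [Set.mem_ofPred_eq, lpNormIcc, htop, ENNReal.toReal_top]
    exact zero_le_one
  intro hb
  obtain ⟨R, hR, hsub⟩ := hb.subset_closedBall_lt 0 0
  have hxn : 0 < ‖x‖ := norm_pos_iff.2 hx0
  have h := hsub (hmem ((R + 1) / ‖x‖) (by positivity))
  rw [mem_closedBall_zero_iff, norm_smul, Real.norm_of_nonneg (by positivity),
    div_mul_cancel₀ _ hxn.ne'] at h
  linarith

theorem compLp_eq_zero_imp_of_inner_ae_eq {α : Type*} [MeasurableSpace α] {μ : Measure α} {n : ℕ}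
    {p : ℝ≥0∞} {T : Euc n →ₗ[ℝ] (α →ₘ[μ] ℝ)} (hT : Function.Injective T) {F : Lp (Euc n) p μ}
    (hTF : ∀ x, (T x : α → ℝ) =ᵐ[μ] fun a => ⟪x, F a⟫) (B : Euc n →L[ℝ] Euc n)
    (hB : B.compLp F = 0) : B = 0 := by
  have hadj : ContinuousLinearMap.adjoint B = 0 := by
    ext1 v
    refine hT ?_
    rw [_root_.zero_apply, map_zero]
    refine AEEqFun.ext ?_
    have h0 : (B.compLp F : α → Euc n) =ᵐ[μ] 0 := by
      rw [hB]; exact Lp.coeFn_zero _ _ _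
    filter_upwards [hTF (ContinuousLinearMap.adjoint B v), B.coeFn_compLp F, h0,
      AEEqFun.coeFn_zero (α := α) (μ := μ) (β := ℝ)] with a h1 h2 h3 h4
    rw [h1, h4, ContinuousLinearMap.adjoint_inner_left, ← h2, h3]
    simp
  have := congrArg ContinuousLinearMap.adjoint hadj
  rwa [ContinuousLinearMap.adjoint_adjoint, map_zero] at this

/-- **Lewis: the unit ball of an n-dimensional subspace of `L_p`, `p > 2`, is within
Banach–Mazur distance `n^{1/2-1/p}` of the Euclidean ball.** -/
theorem lp_subspace_bmDist_euclidean_ball (n : ℕ) (p : ℝ) (hp : 2 < p) (L : Set (Euc n))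
    (hL : IsUnitBallOfLpSubspace n p L) :
    bmDist L (closedBall (0 : Euc n) 1) ≤ (n : ℝ) ^ ((1 : ℝ) / 2 - 1 / p) := by

  obtain ⟨T, hT, rfl⟩ := hL
  have hp0 : 0 < p := by linarith
  by_cases hmem : ∀ x, MemLp (T x) (ENNReal.ofReal p)
      (volume.restrict (Set.Icc (0 : ℝ) 1))
  swap
  · obtain ⟨x, hx⟩ := not_forall.1 hmem
    exact (bmDist_closedBall_le_zero_of_not_isBounded
      (not_isBounded_lpBall_of_not_memLp T hx)).trans (Real.rpow_nonneg (Nat.cast_nonneg n) _)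
  obtain ⟨F, hTF⟩ := exists_lp_inner_ae_eq T hmem
  have hnorm : ∀ x, lpNormIcc p (T x) = (∫ a, |⟪x, F a⟫| ^ p ∂volume.restrict (Set.Icc (0 : ℝ) 1)) ^ p⁻¹ := by
    intro x
    have h0 : 0 ≤ ∫ a, ‖T x a‖ ^ p ∂volume.restrict (Set.Icc (0 : ℝ) 1) := integral_nonneg fun a => by positivity
    rw [lpNormIcc, (hmem x).eLpNorm_eq_integral_rpow_norm (by simpa using hp0) (by simp),
      ENNReal.toReal_ofReal hp0.le, ENNReal.toReal_ofReal (by positivity)]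
    congr 1
    refine integral_congr_ae ?_
    filter_upwards [hTF x] with a ha
    rw [ha, Real.norm_eq_abs]
  have hI0 : ∀ x, 0 ≤ ∫ a, |⟪x, F a⟫| ^ p ∂volume.restrict (Set.Icc (0 : ℝ) 1) := fun x => integral_nonneg fun a => by positivity
  have hball : ∀ x, lpNormIcc p (T x) ≤ 1 ↔ ∫ a, |⟪x, F a⟫| ^ p ∂volume.restrict (Set.Icc (0 : ℝ) 1) ≤ 1 := fun x => by
    rw [hnorm, ← Real.rpow_le_rpow_iff (hI0 x) zero_le_one (inv_pos.2 hp0), Real.one_rpow]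
  rcases Nat.eq_zero_or_pos n with rfl | hn
  · have hexp : (1 : ℝ) / 2 - 1 / p ≠ 0 := by
      have := one_div_lt_one_div_of_lt (by norm_num) hp
      linarith
    rw [Nat.cast_zero, Real.zero_rpow hexp]
    refine le_of_forall_pos_le_add fun ε hε => ?_
    rw [zero_add]
    have hK : {x : Euc 0 | lpNormIcc p (T x) ≤ 1} = Set.univ :=
      Set.eq_univ_of_forall fun x => (hball x).2 (by
        simp [Subsingleton.elim x 0, Real.zero_rpow hp0.ne'])
    rw [hK]
    refine bmDist_le_of_subset (LinearEquiv.refl ℝ (Euc 0)) hε one_pos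
      (fun x _ => ⟨0, ⟨0, by simp, Subsingleton.elim _ _⟩, Subsingleton.elim _ _⟩)
      (fun x _ => ⟨0, trivial, Subsingleton.elim _ _⟩)
  have : NeZero n := ⟨hn.ne'⟩
  have hn' : (0 : ℝ) < n := by exact_mod_cast hn
  obtain ⟨S, hS⟩ := exists_linearEquiv_integral_inner_rpow_le hp F
    (compLp_eq_zero_imp_of_inner_ae_eq hT hTF)
  simp only [finrank_euclideanSpace_fin] at hS
  have hr : (0 : ℝ) < (n : ℝ) ^ ((1 : ℝ) / 2 - 1 / p) := by positivity
  have ha : (0 : ℝ) < √n := by positivity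
  refine bmDist_le_of_subset S hr ha ?_ ?_
  · intro x hx
    have hx1 := (hball x).1 hx
    have h := (hS (S.symm x)).2
    rw [S.apply_symm_apply] at h
    have h1 : ‖S.symm x‖ ^ 2 ≤ n :=
      h.trans (mul_le_of_le_one_right hn'.le (Real.rpow_le_one (hI0 x) hx1 (by positivity)))
    refine ⟨S ((√n)⁻¹ • S.symm x), ⟨_, ?_, rfl⟩, ?_⟩
    · rw [mem_closedBall_zero_iff, norm_smul, norm_inv, Real.norm_of_nonneg ha.le,
        inv_mul_le_iff₀ ha, mul_one]
      exact Real.le_sqrt_of_sq_le h1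
    · simp [smul_smul, ha.ne']
  · rintro _ ⟨_, ⟨w, hw, rfl⟩, rfl⟩
    rw [mem_closedBall_zero_iff] at hw
    set r := (n : ℝ) ^ ((1 : ℝ) / 2 - 1 / p) with hr_def
    refine ⟨S ((r⁻¹ * √n) • w), (hball _).2 ((hS _).1.trans ?_), ?_⟩
    · have hc : r⁻¹ * √n = (n : ℝ) ^ (1 / p) := by
        rw [hr_def, ← Real.rpow_neg hn'.le, Real.sqrt_eq_rpow, ← Real.rpow_add hn']
        congr 1; ring
      rw [div_le_one hn', norm_smul, hc, Real.norm_of_nonneg (by positivity),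
        Real.mul_rpow (by positivity) (norm_nonneg _), ← Real.rpow_mul hn'.le,
        one_div_mul_cancel hp0.ne', Real.rpow_one]
      exact mul_le_of_le_one_right hn'.le (Real.rpow_le_one (norm_nonneg _) hw hp0.le)
    · simp [smul_smul, hr.ne']

end
end

section
/- Let p > 0 and let (ℝⁿ, ‖·‖) be an n-dimensional normed space. Then there is a linear isometric embedding of (ℝⁿ, ‖·‖) into L_p([0,1]) if and only if there exists a finite Borel measure μ on the unit sphere S^{n−1} such that ‖x‖^p = ∫_{S^{n−1}} |⟨x,ξ⟩|^p dμ(ξ) for every x ∈ ℝⁿ. -/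
open MeasureTheory Metric Module
open scoped ENNReal FourierTransform RealInnerProductSpace Pointwise

noncomputable section

/-- The `p`-th power of the `L_p([0,1])` quasi-norm is the integral of `|f|^p`, also when both
sides degenerate to zero. -/
theorem lpNormIcc_rpow {p : ℝ} (hp : 0 < p) (f : ℝ →ₘ[volume.restrict (Set.Icc (0 : ℝ) 1)] ℝ) :
    lpNormIcc p f ^ p = ∫ t in Set.Icc (0 : ℝ) 1, |f t| ^ p := by
  have hf : Measurable f := f.measurable
  rw [lpNormIcc, eLpNorm_eq_lintegral_rpow_enorm_toReal (by simpa using hp) ENNReal.ofReal_ne_top,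
    integral_eq_lintegral_of_nonneg_ae (Filter.Eventually.of_forall fun t => by positivity)
      (hf.abs.pow_const p).aestronglyMeasurable, ENNReal.toReal_rpow, ENNReal.toReal_ofReal hp.le, ← ENNReal.rpow_mul,
    one_div, inv_mul_cancel₀ hp.ne', ENNReal.rpow_one]
  congr 1
  refine lintegral_congr fun t => ?_
  rw [← ENNReal.ofReal_rpow_of_nonneg (abs_nonneg _) hp.le, Real.enorm_eq_ofReal_abs]

theorem lpNormIcc_nonneg (p : ℝ) (f : ℝ →ₘ[volume.restrict (Set.Icc (0 : ℝ) 1)] ℝ) :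
    0 ≤ lpNormIcc p f :=
  ENNReal.toReal_nonneg

theorem IsNormOn.nonneg {n : ℕ} {N : Euc n → ℝ} (hN : IsNormOn n N) (x : Euc n) : 0 ≤ N x := by
  have h := hN.2.2 x ((-1 : ℝ) • x)
  rw [hN.2.1] at h
  have h0 : N (x + (-1 : ℝ) • x) = 0 := (hN.1 _).2 (by simp)
  rw [h0] at h
  norm_num at h
  linarith

theorem memLp_of_lpNormIcc_ne_zero {p : ℝ} {f : ℝ →ₘ[volume.restrict (Set.Icc (0 : ℝ) 1)] ℝ}
    (h : lpNormIcc p f ≠ 0) :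
    MemLp f (ENNReal.ofReal p) (volume.restrict (Set.Icc (0 : ℝ) 1)) :=
  ⟨f.aestronglyMeasurable, lt_top_iff_ne_top.2 fun h' => h (by simp [lpNormIcc, h'])⟩

/-- A linear map into `L_0` is almost everywhere given by pairing with a fixed vector field. -/
theorem exists_measurable_coeFn_eq_inner {n : ℕ} {α : Type*} [MeasurableSpace α] {ν : Measure α}
    (T : Euc n →ₗ[ℝ] (α →ₘ[ν] ℝ)) :
    ∃ F : α → Euc n, Measurable F ∧
      (∀ i t, F t i = T (EuclideanSpace.single i 1) t) ∧
      ∀ x, T x =ᵐ[ν] fun t => ⟪x, F t⟫ := by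
  refine ⟨fun t => WithLp.toLp 2 fun i => T (EuclideanSpace.single i 1) t, ?_, fun _ _ => rfl,
    fun x => ?_⟩
  · have h : ∀ i, Measurable (T (EuclideanSpace.single i 1)) := fun i => AEEqFun.measurable _
    fun_prop
  · have hx : T x = ∑ i, x i • T (EuclideanSpace.single i (1 : ℝ)) := by
      conv_lhs => rw [← (EuclideanSpace.basisFun (Fin n) ℝ).sum_repr x]
      simp
    rw [hx]
    have hs : ∀ᵐ t ∂ν, ∀ i, (x i • T (EuclideanSpace.single i (1 : ℝ)) : α →ₘ[ν] ℝ) t =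
        x i * T (EuclideanSpace.single i (1 : ℝ)) t :=
      ae_all_iff.2 fun i => (AEEqFun.coeFn_smul _ _).mono fun _ ht => ht
    filter_upwards [hs, AEEqFun.coeFn_fun_finsetSum (μ := ν) Finset.univ
      fun i => x i • T (EuclideanSpace.single i (1 : ℝ))] with t ht ht'
    rw [ht', PiLp.inner_apply]
    exact Finset.sum_congr rfl fun i _ => by rw [ht i]; simp [mul_comm]

/-- Polar decomposition: the pushforward of `‖F‖^p` under `F / ‖F‖` represents the `p`-th moments
of the vector field `F`. -/
theorem exists_sphere_measure_integral_inner_rpow {E α : Type*} [NormedAddCommGroup E]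
    [InnerProductSpace ℝ E] [Nontrivial E] [MeasurableSpace E] [BorelSpace E]
    [SecondCountableTopology E] [MeasurableSpace α]
    {ν : Measure α} {p : ℝ} (hp : 0 < p) {F : α → E} (hF : Measurable F)
    (hFp : Integrable (fun t => ‖F t‖ ^ p) ν) :
    ∃ μ : Measure (sphere (0 : E) 1), IsFiniteMeasure μ ∧
      ∀ x : E, ∫ ξ : sphere (0 : E) 1, |⟪x, (ξ : E)⟫| ^ p ∂μ = ∫ t, |⟪x, F t⟫| ^ p ∂ν := by
  classical
  obtain ⟨e, he⟩ := NormedSpace.sphere_nonempty (E := E) (x := 0) (r := 1) |>.2 zero_le_one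
  let g : α → sphere (0 : E) 1 := fun t => ⟨if F t = 0 then e else ‖F t‖⁻¹ • F t, by
    split_ifs with h
    · exact he
    · simp [norm_smul, h]⟩
  have hg : Measurable g :=
    (Measurable.ite (hF (measurableSet_singleton 0)) measurable_const
      (hF.norm.inv.smul hF)).subtype_mk
  have hfin : IsFiniteMeasure (ν.withDensity fun t => ENNReal.ofReal (‖F t‖ ^ p)) :=
    isFiniteMeasure_withDensity_ofReal hFp.2
  refine ⟨(ν.withDensity fun t => ENNReal.ofReal (‖F t‖ ^ p)).map g, inferInstance, fun x => ?_⟩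
  have hc : Continuous fun ξ : sphere (0 : E) 1 => |⟪x, (ξ : E)⟫| ^ p :=
    (by fun_prop : Continuous fun ξ : sphere (0 : E) 1 => |⟪x, (ξ : E)⟫|).rpow_const
      fun _ => Or.inr hp.le
  rw [integral_map hg.aemeasurable hc.measurable.aestronglyMeasurable,
    integral_withDensity_eq_integral_toReal_smul (by fun_prop)
      (Filter.Eventually.of_forall fun _ => ENNReal.ofReal_lt_top)]
  refine integral_congr_ae (Filter.Eventually.of_forall fun t => ?_)
  by_cases h : F t = 0
  · simp [h, hp.ne']
  · have hpos : 0 < ‖F t‖ := norm_pos_iff.2 h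
    simp only [g, h, if_false, inner_smul_right, abs_mul, abs_inv, abs_norm, smul_eq_mul]
    rw [ENNReal.toReal_ofReal (by positivity), ← Real.mul_rpow (by positivity) (by positivity),
      mul_inv_cancel_left₀ hpos.ne']

theorem embedsInLPos_of_isometry {n : ℕ} {p : ℝ} (hp : 0 < p) {N : Euc n → ℝ}
    (hN : IsNormOn n N) :
    (∃ T : Euc n →ₗ[ℝ] (ℝ →ₘ[volume.restrict (Set.Icc (0 : ℝ) 1)] ℝ),
      ∀ x, lpNormIcc p (T x) = N x) → EmbedsInLPos n p N := by
  rintro ⟨T, hT⟩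
  rcases subsingleton_or_nontrivial (Euc n) with hE | hE
  · refine ⟨0, inferInstance, fun x => ?_⟩
    rw [(hN.1 x).2 (Subsingleton.elim _ _), Real.zero_rpow hp.ne', integral_zero_measure]
  obtain ⟨F, hF, hFi, hTF⟩ := exists_measurable_coeFn_eq_inner T
  have hmem : MemLp F (ENNReal.ofReal p) (volume.restrict (Set.Icc (0 : ℝ) 1)) := by
    refine MemLp.of_eval_piLp fun i => ?_
    simp only [hFi]
    refine memLp_of_lpNormIcc_ne_zero ?_
    rw [hT, Ne, hN.1]
    simp
  have hint := hmem.integrable_norm_rpow (by simpa using hp) ENNReal.ofReal_ne_top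
  rw [ENNReal.toReal_ofReal hp.le] at hint
  obtain ⟨μ, hμ, h⟩ := exists_sphere_measure_integral_inner_rpow hp hF hint
  refine ⟨μ, hμ, fun x => ?_⟩
  rw [h, ← hT, lpNormIcc_rpow hp]
  exact integral_congr_ae ((hTF x).mono fun t ht => by simp only [ht])

/-- Every finite measure on a standard Borel space is a multiple of the distribution of a
measurable function on `[0,1]`. -/
theorem exists_measurable_integral_eq {Y : Type*} [MeasurableSpace Y] [StandardBorelSpace Y]
    (μ : Measure Y) [IsFiniteMeasure μ] (hμ : μ ≠ 0) :
    ∃ h : ℝ → Y, Measurable h ∧ ∀ G : Y → ℝ, Measurable G →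
      ∫ y, G y ∂μ = μ.real Set.univ * ∫ t in Set.Icc (0 : ℝ) 1, G (h t) := by
  have : NeZero μ := ⟨hμ⟩
  have : Nonempty Y := μ.nonempty_of_neZero
  obtain ⟨f, hf, hfμ⟩ := ((μ Set.univ)⁻¹ • μ).exists_measurable_map_eq
  refine ⟨fun t => f (Set.projIcc 0 1 zero_le_one t), hf.comp continuous_projIcc.measurable,
    fun G hG => ?_⟩
  have h1 : ∫ t in Set.Icc (0 : ℝ) 1, G (f (Set.projIcc 0 1 zero_le_one t)) =
      ∫ u : unitInterval, G (f u) := by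
    rw [← integral_subtype_comap measurableSet_Icc]
    simp only [Set.projIcc_val]
    rfl
  rw [h1, ← integral_map hf.aemeasurable hG.aestronglyMeasurable, hfμ, integral_smul_measure,
    ENNReal.toReal_inv, smul_eq_mul, Measure.real, mul_inv_cancel_left₀]
  simp [ENNReal.toReal_eq_zero_iff, hμ]

theorem exists_isometry_of_embedsInLPos {n : ℕ} {p : ℝ} (hp : 0 < p) {N : Euc n → ℝ}
    (hN : IsNormOn n N) :
    EmbedsInLPos n p N →
      ∃ T : Euc n →ₗ[ℝ] (ℝ →ₘ[volume.restrict (Set.Icc (0 : ℝ) 1)] ℝ),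
        ∀ x, lpNormIcc p (T x) = N x := by
  rintro ⟨μ, hμ, h⟩
  suffices ∃ T : Euc n →ₗ[ℝ] (ℝ →ₘ[volume.restrict (Set.Icc (0 : ℝ) 1)] ℝ),
      ∀ x, lpNormIcc p (T x) ^ p = N x ^ p by
    obtain ⟨T, hT⟩ := this
    exact ⟨T, fun x => (Real.rpow_left_inj (lpNormIcc_nonneg _ _) (hN.nonneg x) hp.ne').1 (hT x)⟩
  rcases eq_or_ne μ 0 with rfl | hμ0
  · refine ⟨0, fun x => ?_⟩
    rw [h, integral_zero_measure, lpNormIcc, LinearMap.zero_apply, eLpNorm_congr_ae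
      (AEEqFun.coeFn_zero), eLpNorm_zero, ENNReal.toReal_zero, Real.zero_rpow hp.ne']
  obtain ⟨g, hg, hgμ⟩ := exists_measurable_integral_eq μ hμ0
  let c : ℝ := μ.real Set.univ ^ p⁻¹
  have hm : ∀ x : Euc n, AEStronglyMeasurable (fun t => ⟪x, c • (g t : Euc n)⟫)
      (volume.restrict (Set.Icc (0 : ℝ) 1)) := fun x => by
    have := hg.subtype_val
    fun_prop
  refine ⟨{ toFun := fun x => AEEqFun.mk _ (hm x)
            map_add' := fun x y => ?_
            map_smul' := fun a x => ?_ }, fun x => ?_⟩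
  · rw [AEEqFun.mk_add_mk, AEEqFun.mk_eq_mk]
    exact Filter.Eventually.of_forall fun t => inner_add_left _ _ _
  · rw [RingHom.id_apply, AEEqFun.smul_mk, AEEqFun.mk_eq_mk]
    exact Filter.Eventually.of_forall fun t => real_inner_smul_left _ _ _
  · have hG : Measurable fun ξ : sphere (0 : Euc n) 1 => |⟪x, (ξ : Euc n)⟫| ^ p := by fun_prop
    rw [h, hgμ _ hG, lpNormIcc_rpow hp, ← integral_const_mul]
    refine integral_congr_ae ((AEEqFun.coeFn_mk _ (hm x)).mono fun t ht => ?_)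
    have hc : 0 ≤ c := by positivity
    simp only [LinearMap.coe_mk, AddHom.coe_mk]
    rw [ht]
    simp only [real_inner_smul_right]
    rw [abs_mul, abs_of_nonneg hc, Real.mul_rpow hc (abs_nonneg _),
      Real.rpow_inv_rpow measureReal_nonneg hp.ne']

/-- **P. Lévy: an n-dimensional normed space embeds isometrically in `L_p([0,1])`, `p > 0`,
iff its norm has the representation `‖x‖^p = ∫_{S^{n-1}} |⟨x,ξ⟩|^p dμ(ξ)` for a finite Borel
measure `μ` on the sphere.** -/
theorem levy_embedding_iff (n : ℕ) (p : ℝ) (hp : 0 < p) (N : Euc n → ℝ)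
    (hN : IsNormOn n N) :
    (∃ T : Euc n →ₗ[ℝ] (ℝ →ₘ[volume.restrict (Set.Icc (0 : ℝ) 1)] ℝ),
      ∀ x, lpNormIcc p (T x) = N x) ↔ EmbedsInLPos n p N := by
  exact ⟨embedsInLPos_of_isometry hp hN, exists_isometry_of_embedsInLPos hp hN⟩

end
end
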